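/- arXiv:1405.3853 — 2 statements merged into one kernel-verified Lean document; each statement's English description precedes it below -/
import Mathlib

section
/- Let {xⁿ} ⊂ D(ℝ₊, M_d), {zⁿ} ⊂ D(ℝ₊, ℝᵈ) with sup_n V̄_q(xⁿ)_T < ∞, sup_n V_p(zⁿ)_T < ∞ for all T, 1/p + 1/q > 1. If (xⁿ, zⁿ) → (x, z) jointly in the Skorokhod J₁ topology on D(ℝ₊, M_d × ℝᵈ), then x has finite q-variation, z has finite p-variation, and (xⁿ, zⁿ, ∫₀^· xⁿ_{s−} dzⁿ_s) → (x, z, ∫₀^· x_{s−} dz_s) in D(ℝ₊, M_d × ℝᵈ × ℝᵈ). -/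
open Set Filter Function MeasureTheory

noncomputable section

abbrev Eu (d : ℕ) := EuclideanSpace ℝ (Fin d)

def varSums {E : Type*} [NormedAddCommGroup E] (p : ℝ) (x : ℝ → E) (a b : ℝ) : Set ℝ :=
  {v | ∃ (n : ℕ) (t : Fin (n + 1) → ℝ), Monotone t ∧ t 0 = a ∧ t (Fin.last n) = b ∧
    v = ∑ i : Fin n, ‖x (t i.succ) - x (t i.castSucc)‖ ^ p}

/-- p-variation `v_p(x)_{[a,b]}` (supremum over partitions of `[a,b]`). -/
def vpvar {E : Type*} [NormedAddCommGroup E] (p : ℝ) (x : ℝ → E) (a b : ℝ) : ℝ :=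
  sSup (varSums p x a b)

/-- `x` has finite p-variation on `[a,b]`. -/
def HasFinVar {E : Type*} [NormedAddCommGroup E] (p : ℝ) (x : ℝ → E) (a b : ℝ) : Prop :=
  BddAbove (varSums p x a b)

/-- `V_p(x)_{[a,b]} = (v_p(x)_{[a,b]})^{1/p}`. -/
def Vp {E : Type*} [NormedAddCommGroup E] (p : ℝ) (x : ℝ → E) (a b : ℝ) : ℝ :=
  vpvar p x a b ^ (1 / p)

/-- p-variation norm `V̄_p(x)_{[a,b]} = V_p(x)_{[a,b]} + ‖x a‖`. -/
def VpNorm {E : Type*} [NormedAddCommGroup E] (p : ℝ) (x : ℝ → E) (a b : ℝ) : ℝ :=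
  Vp p x a b + ‖x a‖

/-- càdlàg : right-continuous with left limits. -/
def Cadlag {E : Type*} [NormedAddCommGroup E] (x : ℝ → E) : Prop :=
  (∀ t : ℝ, ContinuousWithinAt x (Ici t) t) ∧
  ∀ t : ℝ, ∃ c : E, Tendsto x (nhdsWithin t (Iio t)) (nhds c)
/-- `I` is the Riemann–Stieltjes integral `∫_a^b B(x_s, dz_s)` : limit of left-point
Riemann–Stieltjes sums as the mesh of the partition tends to `0`. -/
def IsRSInt {M Z F : Type*} [NormedAddCommGroup M] [NormedAddCommGroup Z]
    [NormedAddCommGroup F] (B : M → Z → F) (x : ℝ → M) (z : ℝ → Z)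
    (a b : ℝ) (I : F) : Prop :=
  ∀ ε : ℝ, 0 < ε → ∃ δ : ℝ, 0 < δ ∧ ∀ (n : ℕ) (t : Fin (n + 1) → ℝ),
    Monotone t → t 0 = a → t (Fin.last n) = b →
    (∀ i : Fin n, t i.succ - t i.castSucc ≤ δ) →
    ‖(∑ i : Fin n, B (x (t i.castSucc)) (z (t i.succ) - z (t i.castSucc))) - I‖ < ε
/-- Convergence in the Skorokhod `J₁` topology on `D([0,∞), E)`, via the standard
time–change characterization: there are increasing homeomorphisms `lam n` of `ℝ₊`
with `lam n → id` and `x n ∘ lam n → x` locally uniformly. -/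
def J1Tendsto {E : Type*} [NormedAddCommGroup E] (x : ℕ → ℝ → E) (x₀ : ℝ → E) : Prop :=
  ∃ lam : ℕ → ℝ → ℝ,
    (∀ n, StrictMono (lam n)) ∧ (∀ n, Surjective (lam n)) ∧ (∀ n, lam n 0 = 0) ∧
    ∀ T : ℝ, 0 < T →
      Tendsto (fun n => ⨆ t : Icc (0:ℝ) T, |lam n ↑t - ↑t|) atTop (nhds 0) ∧
      Tendsto (fun n => ⨆ t : Icc (0:ℝ) T, ‖x n (lam n ↑t) - x₀ ↑t‖) atTop (nhds 0)

/-- Relative compactness in the Skorokhod `J₁` topology: every subsequence has a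
further subsequence converging in `J₁`. -/
def J1RelCompact {E : Type*} [NormedAddCommGroup E] (x : ℕ → ℝ → E) : Prop :=
  ∀ φ : ℕ → ℕ, StrictMono φ → ∃ ψ : ℕ → ℕ, StrictMono ψ ∧
    ∃ x₀ : ℝ → E, J1Tendsto (fun m => x (φ (ψ m))) x₀

/-- `x` has all its `p`-variation sums over increasing sequences in `[a, b]` bounded by `A`. -/
def VarBound {E : Type*} [NormedAddCommGroup E] (p : ℝ) (x : ℝ → E) (a b A : ℝ) : Prop :=
  ∀ s : ℕ → ℝ, Monotone s → (∀ i, s i ∈ Icc a b) → ∀ m : ℕ,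
    ∑ i ∈ Finset.range m, ‖x (s (i + 1)) - x (s i)‖ ^ p ≤ A

/-- A finite increasing sequence extends to an increasing sequence indexed by `ℕ`. -/
lemma exists_nat_partition {a b : ℝ} {n : ℕ} {t : Fin (n + 1) → ℝ} (ht : Monotone t)
    (h0 : t 0 = a) (hn : t (Fin.last n) = b) :
    ∃ s : ℕ → ℝ, Monotone s ∧ (∀ i, s i ∈ Icc a b) ∧ s 0 = a ∧
      ∀ {F : Type*} [AddCommMonoid F] (f : ℝ → ℝ → F),
        ∑ i : Fin n, f (t i.castSucc) (t i.succ) =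
          ∑ i ∈ Finset.range n, f (s i) (s (i + 1)) := by
  refine ⟨fun i => t ⟨min i n, by omega⟩, ?_, ?_, ?_, ?_⟩
  · intro i j hij
    apply ht
    simp only [Fin.mk_le_mk]
    omega
  · intro i
    constructor
    · rw [← h0]; exact ht (Fin.zero_le _)
    · rw [← hn]; exact ht (Fin.le_last _)
  · rw [← h0]
    congr 1
  · intro F _ f
    rw [← Fin.sum_univ_eq_sum_range
      (fun i => f (t ⟨min i n, by omega⟩) (t ⟨min (i + 1) n, by omega⟩))]
    refine Finset.sum_congr rfl fun i _ => ?_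
    have hi := i.isLt
    congr 2 <;> ext <;> simp

lemma varBound_of_hasFinVar {E : Type*} [NormedAddCommGroup E] {p : ℝ} {x : ℝ → E} {a b A : ℝ}
    (h : HasFinVar p x a b) (hA : vpvar p x a b ≤ A) : VarBound p x a b A := by
  intro s hs hmem m
  let u : ℕ → ℝ := fun i => if i = 0 then a else if i ≤ m + 1 then s (i - 1) else b
  have hu : Monotone u := by
    refine monotone_nat_of_le_succ fun i => ?_
    simp only [u]
    split_ifs <;> first
      | contradiction
      | omega
      | exact le_rfl
      | exact (hmem _).1
      | exact (hmem _).2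
      | exact hs (by omega)
  have hle : ∑ i : Fin (m + 2), ‖x (u (i.succ : Fin (m + 3))) - x (u (i.castSucc))‖ ^ p ≤ A := by
    refine le_trans (le_csSup h ⟨m + 2, fun i => u i, fun i j hij => hu hij, ?_, ?_, rfl⟩) hA
    · simp [u]
    · simp [u]
  refine le_trans ?_ hle
  simp only [Fin.val_succ, Fin.val_castSucc]
  rw [Fin.sum_univ_eq_sum_range (fun i => ‖x (u (i + 1)) - x (u i)‖ ^ p) (m + 2),
    Finset.sum_range_succ, Finset.sum_range_succ']
  have h1 : ∑ i ∈ Finset.range m, ‖x (u (i + 1 + 1)) - x (u (i + 1))‖ ^ p =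
      ∑ i ∈ Finset.range m, ‖x (s (i + 1)) - x (s i)‖ ^ p := by
    refine Finset.sum_congr rfl fun i hi => ?_
    have hi := Finset.mem_range.1 hi
    have e1 : u (i + 1 + 1) = s (i + 1) := by
      simp only [u]; rw [if_neg (by omega), if_pos (by omega)]; rfl
    have e2 : u (i + 1) = s i := by
      simp only [u]; rw [if_neg (by omega), if_pos (by omega)]; rfl
    rw [e1, e2]
  rw [h1]
  have h2 : 0 ≤ ‖x (u (0 + 1)) - x (u 0)‖ ^ p := by positivity
  have h3 : 0 ≤ ‖x (u (m + 1 + 1)) - x (u (m + 1))‖ ^ p := by positivity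
  linarith

lemma VarBound.hasFinVar {E : Type*} [NormedAddCommGroup E] {p : ℝ} {x : ℝ → E} {a b A : ℝ}
    (h : VarBound p x a b A) : HasFinVar p x a b := by
  refine ⟨A, ?_⟩
  rintro v ⟨n, t, ht, h0, hn, rfl⟩
  obtain ⟨s, hs, hmem, -, hsum⟩ := exists_nat_partition ht h0 hn
  rw [hsum fun u v => ‖x v - x u‖ ^ p]
  exact h s hs hmem n

lemma VarBound.comp {E : Type*} [NormedAddCommGroup E] {p : ℝ} {x : ℝ → E} {a b a' b' A : ℝ}
    (h : VarBound p x a b A) {φ : ℝ → ℝ} (hφ : Monotone φ)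
    (hmap : ∀ t ∈ Icc a' b', φ t ∈ Icc a b) : VarBound p (fun t => x (φ t)) a' b' A :=
  fun s hs hmem m => h (fun i => φ (s i)) (hφ.comp hs) (fun i => hmap _ (hmem i)) m

lemma VarBound.sub {E : Type*} [NormedAddCommGroup E] {p : ℝ} (hp : 1 ≤ p) {x y : ℝ → E}
    {a b A B : ℝ} (hx : VarBound p x a b A) (hy : VarBound p y a b B) :
    VarBound p (fun t => x t - y t) a b (2 ^ (p - 1) * (A + B)) := by
  intro s hs hmem m
  calc ∑ i ∈ Finset.range m, ‖(x (s (i + 1)) - y (s (i + 1))) - (x (s i) - y (s i))‖ ^ p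
      ≤ ∑ i ∈ Finset.range m, 2 ^ (p - 1) *
          (‖x (s (i + 1)) - x (s i)‖ ^ p + ‖y (s (i + 1)) - y (s i)‖ ^ p) := by
        refine Finset.sum_le_sum fun i _ => ?_
        have hpow : (‖x (s (i + 1)) - x (s i)‖ + ‖y (s (i + 1)) - y (s i)‖) ^ p ≤ 2 ^ (p - 1) *
            (‖x (s (i + 1)) - x (s i)‖ ^ p + ‖y (s (i + 1)) - y (s i)‖ ^ p) :=
          mod_cast NNReal.rpow_add_le_mul_rpow_add_rpow ‖x (s (i + 1)) - x (s i)‖₊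
            ‖y (s (i + 1)) - y (s i)‖₊ hp
        refine le_trans ?_ hpow
        refine Real.rpow_le_rpow (norm_nonneg _) ?_ (by linarith)
        rw [sub_sub_sub_comm]
        exact norm_sub_le _ _
    _ ≤ 2 ^ (p - 1) * (A + B) := by
        rw [← Finset.mul_sum, Finset.sum_add_distrib]
        exact mul_le_mul_of_nonneg_left (add_le_add (hx s hs hmem m) (hy s hs hmem m))
          (by positivity)

lemma VarBound.of_norm_le {E : Type*} [NormedAddCommGroup E] {p p' : ℝ} (hp : 1 ≤ p)
    (hpp' : p < p') {x : ℝ → E} {a b A ε : ℝ} (hx : VarBound p x a b A)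
    (hε : ∀ t ∈ Icc a b, ‖x t‖ ≤ ε) :
    VarBound p' x a b ((2 * ε) ^ (p' - p) * A) := by
  intro s hs hmem m
  have hε0 : 0 ≤ ε := (norm_nonneg _).trans (hε _ (hmem 0))
  calc ∑ i ∈ Finset.range m, ‖x (s (i + 1)) - x (s i)‖ ^ p'
      ≤ ∑ i ∈ Finset.range m, (2 * ε) ^ (p' - p) * ‖x (s (i + 1)) - x (s i)‖ ^ p := by
        refine Finset.sum_le_sum fun i _ => ?_
        have h1 : ‖x (s (i + 1)) - x (s i)‖ ≤ 2 * ε := by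
          have := norm_sub_le (x (s (i + 1))) (x (s i))
          linarith [hε _ (hmem i), hε _ (hmem (i + 1))]
        have h2 : ‖x (s (i + 1)) - x (s i)‖ ^ p' =
            ‖x (s (i + 1)) - x (s i)‖ ^ (p' - p) * ‖x (s (i + 1)) - x (s i)‖ ^ p := by
          rw [← Real.rpow_add_of_nonneg (norm_nonneg _) (by linarith) (by linarith)]
          congr 1; ring
        rw [h2]
        exact mul_le_mul_of_nonneg_right
          (Real.rpow_le_rpow (norm_nonneg _) h1 (by linarith)) (by positivity)
    _ ≤ (2 * ε) ^ (p' - p) * A := by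
        rw [← Finset.mul_sum]
        exact mul_le_mul_of_nonneg_left (hx s hs hmem m) (by positivity)

lemma VarBound.of_tendsto {E : Type*} [NormedAddCommGroup E] {p : ℝ} (hp : 1 ≤ p)
    {y : ℕ → ℝ → E} {x : ℝ → E} {a b A : ℝ}
    (hlim : ∀ t ∈ Icc a b, Tendsto (fun n => y n t) atTop (nhds (x t)))
    (hy : ∀ᶠ n in atTop, VarBound p (y n) a b A) : VarBound p x a b A := by
  intro s hs hmem m
  refine le_of_tendsto (tendsto_finsetSum _ fun i _ =>
    (((hlim _ (hmem (i + 1))).sub (hlim _ (hmem i))).norm.rpow_const (Or.inr (by linarith))))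
    (hy.mono fun n hn => hn s hs hmem m)

lemma VarBound.norm_sub_le {E : Type*} [NormedAddCommGroup E] {p : ℝ} (hp : 1 ≤ p)
    {x : ℝ → E} {a b A u v : ℝ} (hx : VarBound p x a b A) (hau : a ≤ u) (huv : u ≤ v)
    (hvb : v ≤ b) : ‖x v - x u‖ ≤ A ^ (1 / p) := by
  have h := hx (fun i => if i = 0 then u else v)
    (monotone_nat_of_le_succ fun i => by
      by_cases hi : i = 0 <;> simp [hi, huv])
    (fun i => by
      split_ifs
      · exact ⟨hau, huv.trans hvb⟩
      · exact ⟨hau.trans huv, hvb⟩) 1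
  simp only [Finset.range_one, Finset.sum_singleton, zero_add, one_ne_zero, if_false,
    if_true] at h
  calc ‖x v - x u‖ = (‖x v - x u‖ ^ p) ^ (1 / p) := by
        rw [one_div, Real.rpow_rpow_inv (norm_nonneg _) (by linarith)]
    _ ≤ _ := Real.rpow_le_rpow (by positivity) h (by positivity)

/-- Some product of a pair of terms is at most the geometric bound given by Hölder. -/
lemma exists_mul_le_of_sum_rpow_le {p q : ℝ} (hp : 1 ≤ p) (hq : 1 ≤ q) {A B : ℝ} (hA : 0 < A)
    (hB : 0 < B) {n : ℕ} {a b : ℕ → ℝ} (ha : ∀ i, 0 ≤ a i) (hb : ∀ i, 0 ≤ b i)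
    (haA : ∑ i ∈ Finset.range (n + 1), a i ^ q ≤ A)
    (hbB : ∑ i ∈ Finset.range (n + 1), b i ^ p ≤ B) :
    ∃ i ≤ n, a i * b i ≤
      (1 / ((n : ℝ) + 1)) ^ (1 / p + 1 / q) * (A ^ (1 / q) * B ^ (1 / p)) := by
  have hp0 : 0 < p := by linarith
  have hq0 : 0 < q := by linarith
  set θ := 1 / p + 1 / q with hθ
  have hθ0 : 0 < θ := by positivity
  set w₁ := 1 / (q * θ) with hw₁
  set w₂ := 1 / (p * θ) with hw₂
  have hw : w₁ + w₂ = 1 := by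
    rw [hw₁, hw₂, hθ]; field_simp; ring
  have hw₁0 : 0 ≤ w₁ := by positivity
  have hw₂0 : 0 ≤ w₂ := by positivity
  have hsum : ∑ i ∈ Finset.range (n + 1), (w₁ * (a i ^ q / A) + w₂ * (b i ^ p / B)) ≤
      ∑ i ∈ Finset.range (n + 1), 1 / ((n : ℝ) + 1) := by
    rw [Finset.sum_add_distrib, ← Finset.mul_sum, ← Finset.mul_sum, ← Finset.sum_div,
      ← Finset.sum_div, Finset.sum_const, Finset.card_range, nsmul_eq_mul]
    have h1 : (∑ i ∈ Finset.range (n + 1), a i ^ q) / A ≤ 1 := (div_le_one hA).2 haA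
    have h2 : (∑ i ∈ Finset.range (n + 1), b i ^ p) / B ≤ 1 := (div_le_one hB).2 hbB
    have h3 : ((n + 1 : ℕ) : ℝ) * (1 / ((n : ℝ) + 1)) = 1 := by push_cast; field_simp
    rw [h3]
    nlinarith
  obtain ⟨i, hi, hle⟩ := Finset.exists_le_of_sum_le ⟨0, by simp⟩ hsum
  refine ⟨i, Nat.lt_succ_iff.1 (Finset.mem_range.1 hi), ?_⟩
  have hai := ha i
  have hbi := hb i
  have hg := (Real.geom_mean_le_arith_mean2_weighted hw₁0 hw₂0
    (by positivity : 0 ≤ a i ^ q / A) (by positivity : 0 ≤ b i ^ p / B) hw).trans hle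
  have hg' := Real.rpow_le_rpow (by positivity) hg hθ0.le
  rw [Real.mul_rpow (by positivity) (by positivity), ← Real.rpow_mul (by positivity),
    ← Real.rpow_mul (by positivity)] at hg'
  have e1 : w₁ * θ = 1 / q := by rw [hw₁]; field_simp
  have e2 : w₂ * θ = 1 / p := by rw [hw₂]; field_simp
  rw [e1, e2, Real.div_rpow (by positivity) hA.le, Real.div_rpow (by positivity) hB.le,
    one_div q, one_div p, Real.rpow_rpow_inv hai hq0.ne', Real.rpow_rpow_inv hbi hp0.ne',
    div_mul_div_comm, div_le_iff₀ (by positivity)] at hg'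
  rw [one_div q, one_div p]
  exact hg'

section Young

variable {E F : Type*} [NormedAddCommGroup E] [NormedSpace ℝ E] [NormedAddCommGroup F]
  [NormedSpace ℝ F]

/-- Effect on a left-point sum of deleting the point with index `i + 1`. -/
lemma sum_delete_point (X : ℕ → E →L[ℝ] F) (Z : ℕ → E) {i n : ℕ} (hin : i ≤ n) :
    ∑ k ∈ Finset.range (n + 2), X k (Z (k + 1) - Z k) =
      ∑ k ∈ Finset.range (n + 1), X (if k ≤ i then k else k + 1)
        (Z (if k + 1 ≤ i then k + 1 else k + 1 + 1) - Z (if k ≤ i then k else k + 1)) +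
      (X (i + 1) - X i) (Z (i + 2) - Z (i + 1)) := by
  induction n, hin using Nat.le_induction with
  | base =>
    rw [Finset.sum_range_succ, Finset.sum_range_succ, Finset.sum_range_succ]
    have h : ∑ k ∈ Finset.range i, X (if k ≤ i then k else k + 1)
        (Z (if k + 1 ≤ i then k + 1 else k + 1 + 1) - Z (if k ≤ i then k else k + 1)) =
        ∑ k ∈ Finset.range i, X k (Z (k + 1) - Z k) := by
      refine Finset.sum_congr rfl fun k hk => ?_
      have hk := Finset.mem_range.1 hk
      rw [if_pos (by omega), if_pos (by omega)]
    rw [h, if_pos le_rfl, if_neg (by omega)]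
    simp only [sub_apply, map_sub]
    abel
  | succ n hn ih =>
    rw [Finset.sum_range_succ, ih, Finset.sum_range_succ _ (n + 1), if_neg (by omega),
      if_neg (by omega)]
    abel

/-- Discrete Young inequality for sequences. -/
lemma norm_sum_sub_le_of_variation {p q : ℝ} (hp : 1 ≤ p) (hq : 1 ≤ q) {A B : ℝ} (hA : 0 < A)
    (hB : 0 < B) (n : ℕ) (X : ℕ → E →L[ℝ] F) (Z : ℕ → E)
    (hX : ∀ σ : ℕ → ℕ, Monotone σ → ∀ m,
      ∑ i ∈ Finset.range m, ‖X (σ (i + 1)) - X (σ i)‖ ^ q ≤ A)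
    (hZ : ∀ σ : ℕ → ℕ, Monotone σ → ∀ m,
      ∑ i ∈ Finset.range m, ‖Z (σ (i + 1)) - Z (σ i)‖ ^ p ≤ B) :
    ‖∑ k ∈ Finset.range (n + 1), X k (Z (k + 1) - Z k) - X 0 (Z (n + 1) - Z 0)‖ ≤
      (∑ k ∈ Finset.range n, (1 / ((k : ℝ) + 1)) ^ (1 / p + 1 / q)) *
        (A ^ (1 / q) * B ^ (1 / p)) := by
  induction n generalizing X Z with
  | zero => simp
  | succ n ih =>
    obtain ⟨i, hin, hi⟩ := exists_mul_le_of_sum_rpow_le hp hq hA hB (n := n)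
      (a := fun i => ‖X (i + 1) - X i‖) (b := fun i => ‖Z (i + 2) - Z (i + 1)‖)
      (fun _ => norm_nonneg _) (fun _ => norm_nonneg _)
      (hX id monotone_id _) (hZ (fun i => i + 1) (fun _ _ h => Nat.succ_le_succ h) _)
    let δ : ℕ → ℕ := fun k => if k ≤ i then k else k + 1
    have hδm : Monotone δ := by
      refine monotone_nat_of_le_succ fun k => ?_
      simp only [δ]
      split_ifs <;> omega
    have h := ih (fun k => X (δ k)) (fun k => Z (δ k))
      (fun σ hσ m => hX (fun k => δ (σ k)) (hδm.comp hσ) m)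
      (fun σ hσ m => hZ (fun k => δ (σ k)) (hδm.comp hσ) m)
    have e0 : δ 0 = 0 := by simp [δ]
    have e1 : δ (n + 1) = n + 2 := by simp only [δ]; rw [if_neg (by omega)]
    simp only [e0, e1] at h
    rw [sum_delete_point X Z hin, add_sub_right_comm,
      Finset.sum_range_succ (fun k : ℕ => (1 / ((k : ℝ) + 1)) ^ (1 / p + 1 / q)) n, add_mul]
    refine (norm_add_le _ _).trans (add_le_add h ?_)
    exact (ContinuousLinearMap.le_opNorm _ _).trans hi

lemma summable_one_div_add_one_rpow {θ : ℝ} (hθ : 1 < θ) :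
    Summable fun k : ℕ => (1 / ((k : ℝ) + 1)) ^ θ := by
  have h := (summable_nat_add_iff 1).2 (Real.summable_one_div_nat_rpow.2 hθ)
  refine h.congr fun k => ?_
  rw [Real.div_rpow zero_le_one (by positivity), Real.one_rpow]
  push_cast
  rfl

/-- Discrete Young inequality, with the constant of the Loève–Young estimate. -/
lemma VarBound.norm_sum_le {p q : ℝ} (hp : 1 ≤ p) (hq : 1 ≤ q) (hpq : 1 < 1 / p + 1 / q)
    {a b A B : ℝ} (hA : 0 < A) (hB : 0 < B) {x : ℝ → E →L[ℝ] F} {z : ℝ → E}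
    (hx : VarBound q x a b A) (hz : VarBound p z a b B) {s : ℕ → ℝ} (hs : Monotone s)
    (hmem : ∀ i, s i ∈ Icc a b) (n : ℕ) :
    ‖∑ k ∈ Finset.range n, x (s k) (z (s (k + 1)) - z (s k))‖ ≤
      ‖x (s 0)‖ * ‖z (s n) - z (s 0)‖ +
      (∑' k : ℕ, (1 / ((k : ℝ) + 1)) ^ (1 / p + 1 / q)) * (A ^ (1 / q) * B ^ (1 / p)) := by
  have hnn : ∀ k : ℕ, 0 ≤ (1 / ((k : ℝ) + 1)) ^ (1 / p + 1 / q) := fun k => by positivity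
  cases n with
  | zero =>
    have h : 0 ≤ ∑' k : ℕ, (1 / ((k : ℝ) + 1)) ^ (1 / p + 1 / q) := tsum_nonneg hnn
    simp only [Finset.range_zero, Finset.sum_empty, norm_zero]
    positivity
  | succ n =>
    have h := norm_sum_sub_le_of_variation hp hq hA hB n (fun k => x (s k)) (fun k => z (s k))
      (fun σ hσ m => hx (fun k => s (σ k)) (hs.comp hσ) (fun i => hmem _) m)
      (fun σ hσ m => hz (fun k => s (σ k)) (hs.comp hσ) (fun i => hmem _) m)
    have h2 := (summable_one_div_add_one_rpow hpq).sum_le_tsum (Finset.range n)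
      (fun k _ => hnn k)
    have h3 := mul_le_mul_of_nonneg_right h2
      (by positivity : 0 ≤ A ^ (1 / q) * B ^ (1 / p))
    have h4 := (x (s 0)).le_opNorm (z (s (n + 1)) - z (s 0))
    have h5 := norm_le_norm_add_norm_sub (x (s 0) (z (s (n + 1)) - z (s 0)))
      (∑ k ∈ Finset.range (n + 1), x (s k) (z (s (k + 1)) - z (s k)))
    rw [norm_sub_rev] at h5
    linarith

lemma exists_gt_one_lt_add_one_div {p q : ℝ} (hq : 1 ≤ q) (hpq : 1 < 1 / p + 1 / q) :
    ∃ q' > q, 1 < 1 / p + 1 / q' := by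
  have hc : ContinuousAt (fun r : ℝ => 1 / p + 1 / r) q :=
    continuousAt_const.add (continuousAt_const.div continuousAt_id (by simp; linarith))
  have h := (hc.eventually (lt_mem_nhds hpq)).filter_mono (nhdsWithin_le_nhds (s := Ioi q))
  obtain ⟨r, hr, hqr⟩ := (h.and self_mem_nhdsWithin).exists
  exact ⟨r, hqr, hr⟩

/-- Left-point Riemann–Stieltjes sums depend on the paths continuously in the uniform norm,
uniformly over partitions, as long as the variations stay bounded. -/
lemma exists_norm_sum_sub_sum_le {p q : ℝ} (hp : 1 ≤ p) (hq : 1 ≤ q)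
    (hpq : 1 < 1 / p + 1 / q) {A B K η : ℝ} (hA : 0 < A) (hB : 0 < B) (hK : 0 ≤ K)
    (hη : 0 < η) :
    ∃ ε > 0, ∀ (a b : ℝ) (x y : ℝ → E →L[ℝ] F) (z w : ℝ → E),
      VarBound q x a b A → VarBound q y a b A → VarBound p z a b B → VarBound p w a b B →
      ‖x a‖ ≤ K → (∀ t ∈ Icc a b, ‖y t - x t‖ ≤ ε) → (∀ t ∈ Icc a b, ‖w t - z t‖ ≤ ε) →
      ∀ (n : ℕ) (s : ℕ → ℝ), Monotone s → (∀ i, s i ∈ Icc a b) → s 0 = a →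
        ‖∑ k ∈ Finset.range n, y (s k) (w (s (k + 1)) - w (s k)) -
          ∑ k ∈ Finset.range n, x (s k) (z (s (k + 1)) - z (s k))‖ ≤ η := by
  obtain ⟨q', hqq', hpq'⟩ := exists_gt_one_lt_add_one_div hq hpq
  obtain ⟨p', hpp', hqp'⟩ := exists_gt_one_lt_add_one_div hp (by rwa [add_comm] at hpq)
  rw [add_comm] at hqp'
  set C₁ := ∑' k : ℕ, (1 / ((k : ℝ) + 1)) ^ (1 / p + 1 / q')
  set C₂ := ∑' k : ℕ, (1 / ((k : ℝ) + 1)) ^ (1 / p' + 1 / q)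
  let A' : ℝ → ℝ := fun ε => (2 * ε) ^ (q' - q) * (2 ^ (q - 1) * (A + A))
  let B' : ℝ → ℝ := fun ε => (2 * ε) ^ (p' - p) * (2 ^ (p - 1) * (B + B))
  let G : ℝ → ℝ := fun ε => (ε * B ^ (1 / p) + C₁ * (A' ε ^ (1 / q') * B ^ (1 / p))) +
    (K * (2 * ε) + C₂ * (A ^ (1 / q) * B' ε ^ (1 / p')))
  have hq'0 : 0 < q' := by linarith
  have hp'0 : 0 < p' := by linarith
  have hA'c : Continuous A' :=
    ((continuous_const.mul continuous_id).rpow_const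
      fun _ => Or.inr (by linarith)).mul continuous_const
  have hB'c : Continuous B' :=
    ((continuous_const.mul continuous_id).rpow_const
      fun _ => Or.inr (by linarith)).mul continuous_const
  have hA'c' : Continuous fun ε => A' ε ^ (1 / q') :=
    hA'c.rpow_const fun _ => Or.inr (by positivity)
  have hB'c' : Continuous fun ε => B' ε ^ (1 / p') :=
    hB'c.rpow_const fun _ => Or.inr (by positivity)
  have hGc : Continuous G := by
    simp only [G]
    fun_prop
  have hG0 : G 0 = 0 := by
    have h1 : q' - q ≠ 0 := by linarith
    have h2 : p' - p ≠ 0 := by linarith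
    simp [G, A', B', Real.zero_rpow h1, Real.zero_rpow h2,
      Real.zero_rpow (inv_ne_zero hq'0.ne'), Real.zero_rpow (inv_ne_zero hp'0.ne')]
  have hev := (hGc.continuousAt.eventually (gt_mem_nhds (by rwa [hG0] : G 0 < η))).filter_mono
    (nhdsWithin_le_nhds (s := Ioi 0))
  obtain ⟨ε, hGε, hε⟩ := (hev.and self_mem_nhdsWithin).exists
  have hε : 0 < ε := hε
  refine ⟨ε, hε, fun a b x y z w hx hy hz hw hxa hyx hwz n s hs hmem hs0 => ?_⟩
  have hA' : 0 < A' ε := by simp only [A']; positivity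
  have hB' : 0 < B' ε := by simp only [B']; positivity
  have hyx' : VarBound q' (fun t => y t - x t) a b (A' ε) := (hy.sub hq hx).of_norm_le hq hqq' hyx
  have hwz' : VarBound p' (fun t => w t - z t) a b (B' ε) := (hw.sub hp hz).of_norm_le hp hpp' hwz
  have h1 := hyx'.norm_sum_le hp (by linarith) hpq' hA' hB hw hs hmem n
  have h2 := hx.norm_sum_le (by linarith) hq hqp' hA hB' hwz' hs hmem n
  have h3 : ‖w (s n) - w (s 0)‖ ≤ B ^ (1 / p) :=
    hw.norm_sub_le hp (hmem 0).1 (hs (Nat.zero_le n)) (hmem n).2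
  have h4 : ‖(w (s n) - z (s n)) - (w (s 0) - z (s 0))‖ ≤ 2 * ε := by
    have := norm_sub_le (w (s n) - z (s n)) (w (s 0) - z (s 0))
    linarith [hwz _ (hmem n), hwz _ (hmem 0)]
  have h5 : ‖y (s 0) - x (s 0)‖ * ‖w (s n) - w (s 0)‖ ≤ ε * B ^ (1 / p) :=
    mul_le_mul (hyx _ (hmem 0)) h3 (norm_nonneg _) hε.le
  have h6 : ‖x (s 0)‖ * ‖(w (s n) - z (s n)) - (w (s 0) - z (s 0))‖ ≤ K * (2 * ε) :=
    mul_le_mul (by rwa [hs0]) h4 (norm_nonneg _) hK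
  have hsplit : ∑ k ∈ Finset.range n, y (s k) (w (s (k + 1)) - w (s k)) -
      ∑ k ∈ Finset.range n, x (s k) (z (s (k + 1)) - z (s k)) =
      ∑ k ∈ Finset.range n, (y (s k) - x (s k)) (w (s (k + 1)) - w (s k)) +
      ∑ k ∈ Finset.range n,
        x (s k) ((w (s (k + 1)) - z (s (k + 1))) - (w (s k) - z (s k))) := by
    rw [← Finset.sum_sub_distrib, ← Finset.sum_add_distrib]
    refine Finset.sum_congr rfl fun k _ => ?_
    simp only [sub_apply, map_sub]
    abel
  rw [hsplit]
  refine (norm_add_le _ _).trans ?_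
  simp only [G] at hGε
  linarith

/-- The version of `exists_norm_sum_sub_sum_le` for partitions indexed by `Fin`. -/
lemma exists_norm_finSum_sub_finSum_le {p q : ℝ} (hp : 1 ≤ p) (hq : 1 ≤ q)
    (hpq : 1 < 1 / p + 1 / q) {A B K η : ℝ} (hA : 0 < A) (hB : 0 < B) (hK : 0 ≤ K)
    (hη : 0 < η) :
    ∃ ε > 0, ∀ (a b : ℝ) (x y : ℝ → E →L[ℝ] F) (z w : ℝ → E),
      VarBound q x a b A → VarBound q y a b A → VarBound p z a b B → VarBound p w a b B →
      ‖x a‖ ≤ K → (∀ t ∈ Icc a b, ‖y t - x t‖ ≤ ε) → (∀ t ∈ Icc a b, ‖w t - z t‖ ≤ ε) →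
      ∀ (n : ℕ) (t : Fin (n + 1) → ℝ), Monotone t → t 0 = a → t (Fin.last n) ≤ b →
        ‖∑ i : Fin n, y (t i.castSucc) (w (t i.succ) - w (t i.castSucc)) -
          ∑ i : Fin n, x (t i.castSucc) (z (t i.succ) - z (t i.castSucc))‖ ≤ η := by
  obtain ⟨ε, hε, h⟩ := exists_norm_sum_sub_sum_le (E := E) (F := F) hp hq hpq hA hB hK hη
  refine ⟨ε, hε, fun a b x y z w hx hy hz hw hxa hyx hwz n t ht h0 hn => ?_⟩
  obtain ⟨s, hs, hmem, hs0, hsum⟩ := exists_nat_partition ht h0 rfl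
  rw [hsum fun u v => y u (w v - w u), hsum fun u v => x u (z v - z u)]
  exact h a b x y z w hx hy hz hw hxa hyx hwz n s hs
    (fun i => ⟨(hmem i).1, (hmem i).2.trans hn⟩) hs0

end Young

lemma Cadlag.exists_norm_le {E : Type*} [NormedAddCommGroup E] {x : ℝ → E} (hx : Cadlag x)
    (a b : ℝ) : ∃ C, ∀ t ∈ Icc a b, ‖x t‖ ≤ C := by
  refine (isCompact_Icc (a := a) (b := b)).induction_on
    (p := fun s => ∃ C, ∀ t ∈ s, ‖x t‖ ≤ C) ⟨0, by simp⟩ ?_ ?_ ?_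
  · rintro s t hst ⟨C, hC⟩
    exact ⟨C, fun u hu => hC u (hst hu)⟩
  · rintro s t ⟨C, hC⟩ ⟨D, hD⟩
    refine ⟨max C D, fun u hu => ?_⟩
    rcases hu with hu | hu
    · exact (hC u hu).trans (le_max_left _ _)
    · exact (hD u hu).trans (le_max_right _ _)
  · intro t _
    obtain ⟨c, hc⟩ := hx.2 t
    set D := max (‖c‖ + 1) (‖x t‖ + 1)
    have h1 : ∀ᶠ u in nhdsWithin t (Iio t), ‖x u‖ ≤ D := by
      filter_upwards [hc.norm.eventually (gt_mem_nhds (lt_add_one ‖c‖))] with u hu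
      exact hu.le.trans (le_max_left _ _)
    have h2 : ∀ᶠ u in nhdsWithin t (Ici t), ‖x u‖ ≤ D := by
      filter_upwards [(hx.1 t).norm.eventually (gt_mem_nhds (lt_add_one ‖x t‖))] with u hu
      exact hu.le.trans (le_max_right _ _)
    have h3 : ∀ᶠ u in nhds t, ‖x u‖ ≤ D := by
      rw [← nhdsLT_sup_nhdsGE, eventually_sup]
      exact ⟨h1, h2⟩
    exact ⟨_, mem_nhdsWithin_of_mem_nhds h3, D, fun u hu => hu⟩

section RSInt

variable {M Z F : Type*} [NormedAddCommGroup M] [NormedAddCommGroup Z] [NormedAddCommGroup F]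
  {B : M → Z → F}

/-- Riemann–Stieltjes integrals are invariant under changes of time. -/
lemma IsRSInt.comp {x : ℝ → M} {z : ℝ → Z} {a b : ℝ} {I : F} {φ : ℝ → ℝ} (hφ : Monotone φ)
    (hφc : Continuous φ) (h : IsRSInt B x z (φ a) (φ b) I) :
    IsRSInt B (fun t => x (φ t)) (fun t => z (φ t)) a b I := by
  intro ε hε
  obtain ⟨δ, hδ, hI⟩ := h ε hε
  have huc := (isCompact_Icc (a := a) (b := b)).uniformContinuousOn_of_continuous
    hφc.continuousOn
  obtain ⟨ρ, hρ, hφρ⟩ := Metric.uniformContinuousOn_iff_le.1 huc δ hδ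
  refine ⟨ρ, hρ, fun n t ht h0 hn hmesh => ?_⟩
  have hmem : ∀ i, t i ∈ Icc a b := fun i => ⟨h0 ▸ ht (Fin.zero_le i), hn ▸ ht (Fin.le_last i)⟩
  refine hI n (fun i => φ (t i)) (hφ.comp ht) (congrArg φ h0) (congrArg φ hn) fun i => ?_
  have hle : t i.castSucc ≤ t i.succ := ht (Fin.castSucc_le_succ i)
  have hd := hφρ _ (hmem i.succ) _ (hmem i.castSucc)
    (by rw [Real.dist_eq, abs_of_nonneg (by linarith)]; exact hmesh i)
  exact (le_abs_self _).trans hd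

/-- There are partitions of `[a, b]` with arbitrarily small mesh. -/
lemma exists_partition_mesh_le {a b δ : ℝ} (hab : a ≤ b) (hδ : 0 < δ) :
    ∃ (n : ℕ) (t : Fin (n + 1) → ℝ), Monotone t ∧ t 0 = a ∧ t (Fin.last n) = b ∧
      ∀ i : Fin n, t i.succ - t i.castSucc ≤ δ := by
  obtain ⟨n, hn⟩ := exists_nat_gt ((b - a) / δ)
  have hn0 : (0 : ℝ) < n := lt_of_le_of_lt (div_nonneg (sub_nonneg.2 hab) hδ.le) hn
  have hstep : 0 ≤ (b - a) / n := div_nonneg (sub_nonneg.2 hab) hn0.le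
  refine ⟨n, fun i => a + (i : ℕ) * ((b - a) / n), fun i j hij => ?_, by simp, ?_, fun i => ?_⟩
  · have : ((i : ℕ) : ℝ) ≤ (j : ℕ) := by exact_mod_cast hij
    simp only
    gcongr
  · simp only [Fin.val_last]
    field_simp
    ring
  · have : (b - a) / n ≤ δ := by
      rw [div_lt_iff₀ hδ] at hn
      rw [div_le_iff₀ hn0]
      linarith
    simp only [Fin.val_succ, Fin.val_castSucc]
    push_cast
    linarith

lemma IsRSInt.norm_sub_le {x y : ℝ → M} {z w : ℝ → Z} {a b η : ℝ} {I J : F} (hab : a ≤ b)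
    (hI : IsRSInt B x z a b I) (hJ : IsRSInt B y w a b J)
    (h : ∀ (n : ℕ) (t : Fin (n + 1) → ℝ), Monotone t → t 0 = a → t (Fin.last n) = b →
      ‖∑ i : Fin n, B (x (t i.castSucc)) (z (t i.succ) - z (t i.castSucc)) -
        ∑ i : Fin n, B (y (t i.castSucc)) (w (t i.succ) - w (t i.castSucc))‖ ≤ η) :
    ‖I - J‖ ≤ η := by
  refine le_of_forall_pos_le_add fun ε hε => ?_
  obtain ⟨δ₁, hδ₁, h₁⟩ := hI (ε / 2) (by linarith)
  obtain ⟨δ₂, hδ₂, h₂⟩ := hJ (ε / 2) (by linarith)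
  obtain ⟨n, t, ht, h0, hn, hmesh⟩ := exists_partition_mesh_le hab (lt_min hδ₁ hδ₂)
  have e₁ := h₁ n t ht h0 hn fun i => (hmesh i).trans (min_le_left _ _)
  have e₂ := h₂ n t ht h0 hn fun i => (hmesh i).trans (min_le_right _ _)
  have e := h n t ht h0 hn
  rw [norm_sub_rev] at e₁
  set S := ∑ i : Fin n, B (x (t i.castSucc)) (z (t i.succ) - z (t i.castSucc))
  set S' := ∑ i : Fin n, B (y (t i.castSucc)) (w (t i.succ) - w (t i.castSucc))
  have hsplit : I - J = (I - S) + (S - S') + (S' - J) := by abel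
  rw [hsplit]
  linarith [norm_add₃_le (a := I - S) (b := S - S') (c := S' - J)]

end RSInt

lemma eventually_forall_le_of_tendsto_iSup {α : Type*} {f : ℕ → α → ℝ}
    (h : Tendsto (fun n => ⨆ a, f n a) atTop (nhds 0)) (hf : ∀ n, BddAbove (range (f n)))
    {ε : ℝ} (hε : 0 < ε) : ∀ᶠ n in atTop, ∀ a, f n a ≤ ε := by
  filter_upwards [h.eventually (gt_mem_nhds hε)] with n hn a
  exact (le_ciSup (hf n) a).trans hn.le

lemma tendsto_iSup_of_eventually_forall_le {α : Type*} {f : ℕ → α → ℝ}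
    (hf : ∀ n a, 0 ≤ f n a) (h : ∀ ε > 0, ∀ᶠ n in atTop, ∀ a, f n a ≤ ε) :
    Tendsto (fun n => ⨆ a, f n a) atTop (nhds 0) := by
  refine Metric.tendsto_nhds.2 fun ε hε => ?_
  filter_upwards [h (ε / 2) (by linarith)] with n hn
  rw [Real.dist_0_eq_abs, abs_of_nonneg (Real.iSup_nonneg (hf n))]
  linarith [Real.iSup_le hn (by linarith : 0 ≤ ε / 2)]

/-- A uniform bound on the `p`-variation seminorms gives a uniform bound on variation sums. -/
lemma exists_varBound {E : Type*} [NormedAddCommGroup E] {p : ℝ} (hp : 1 ≤ p) {x : ℕ → ℝ → E}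
    {a b M : ℝ} (hf : ∀ n, HasFinVar p (x n) a b) (hM : ∀ n, Vp p (x n) a b ≤ M) :
    ∃ A > 0, ∀ n, VarBound p (x n) a b A := by
  refine ⟨|M| ^ p + 1, by positivity, fun n => varBound_of_hasFinVar (hf n) ?_⟩
  have h0 : 0 ≤ vpvar p (x n) a b := by
    refine Real.sSup_nonneg ?_
    rintro v ⟨m, t, -, -, -, rfl⟩
    positivity
  have h1 : vpvar p (x n) a b ^ (1 / p) ≤ |M| := (hM n).trans (le_abs_self M)
  have h2 := Real.rpow_le_rpow (by positivity) h1 (by linarith : 0 ≤ p)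
  rw [one_div, Real.rpow_inv_rpow h0 (by linarith)] at h2
  linarith

theorem integrals_converge (d : ℕ) (p q : ℝ) (hp : 1 ≤ p) (hq : 1 ≤ q)
    (hpq : 1 < 1 / p + 1 / q)
    (xn : ℕ → ℝ → (Eu d →L[ℝ] Eu d)) (zn : ℕ → ℝ → Eu d)
    (x : ℝ → (Eu d →L[ℝ] Eu d)) (z : ℝ → Eu d)
    (hxc : ∀ n, Cadlag (xn n)) (hzc : ∀ n, Cadlag (zn n))
    (hxcl : Cadlag x) (hzcl : Cadlag z)
    (hxf : ∀ (n : ℕ) (T : ℝ), 0 ≤ T → HasFinVar q (xn n) 0 T)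
    (hzf : ∀ (n : ℕ) (T : ℝ), 0 ≤ T → HasFinVar p (zn n) 0 T)
    (hxb : ∀ T : ℝ, 0 ≤ T → ∃ M : ℝ, ∀ n, VpNorm q (xn n) 0 T ≤ M)
    (hzb : ∀ T : ℝ, 0 ≤ T → ∃ M : ℝ, ∀ n, Vp p (zn n) 0 T ≤ M)
    (In : ℕ → ℝ → Eu d) (hIn0 : ∀ n, In n 0 = 0)
    (hIn : ∀ (n : ℕ) (t : ℝ), 0 ≤ t →
      IsRSInt (fun (A : Eu d →L[ℝ] Eu d) (v : Eu d) => A v) (xn n) (zn n) 0 t (In n t))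
    (hconv : J1Tendsto (fun n => fun t => (xn n t, zn n t)) (fun t => (x t, z t))) :
    (∀ T : ℝ, 0 ≤ T → HasFinVar q x 0 T ∧ HasFinVar p z 0 T) ∧
    ∃ I : ℝ → Eu d, I 0 = 0 ∧
      (∀ t : ℝ, 0 ≤ t →
        IsRSInt (fun (A : Eu d →L[ℝ] Eu d) (v : Eu d) => A v) x z 0 t (I t)) ∧
      J1Tendsto (fun n => fun t => (xn n t, zn n t, In n t))
        (fun t => (x t, z t, I t)) := by

  obtain ⟨lam, hmono, hsurj, hlam0, hT⟩ := hconv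
  have hlamc : ∀ n, Continuous (lam n) := fun n =>
    (hmono n).monotone.continuous_of_surjective (hsurj n)
  -- the local uniform convergence along the time changes
  have htime : ∀ T : ℝ, 0 < T → ∀ᶠ n in atTop, ∀ t ∈ Icc 0 T, lam n t ∈ Icc 0 (T + 1) := by
    intro T hT0
    have hbdd : ∀ n, BddAbove (range fun t : Icc (0:ℝ) T => |lam n ↑t - ↑t|) := by
      intro n
      refine ⟨lam n T + T, ?_⟩
      rintro _ ⟨⟨t, ht⟩, rfl⟩
      have h0 : 0 ≤ lam n t := hlam0 n ▸ (hmono n).monotone ht.1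
      have h1 : lam n t ≤ lam n T := (hmono n).monotone ht.2
      exact abs_le.2 ⟨by linarith [ht.1, ht.2], by linarith [ht.1, ht.2]⟩
    filter_upwards [eventually_forall_le_of_tendsto_iSup (hT T hT0).1 hbdd one_pos]
      with n hn t ht
    have h0 : 0 ≤ lam n t := hlam0 n ▸ (hmono n).monotone ht.1
    have h1 := abs_le.1 (hn ⟨t, ht⟩)
    exact ⟨h0, by linarith [h1.2, ht.2]⟩
  have hunif : ∀ T : ℝ, 0 < T → ∀ ε > 0, ∀ᶠ n in atTop, ∀ t ∈ Icc 0 T,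
      ‖xn n (lam n t) - x t‖ ≤ ε ∧ ‖zn n (lam n t) - z t‖ ≤ ε := by
    intro T hT0 ε hε
    have hbdd : ∀ n, BddAbove (range fun t : Icc (0:ℝ) T =>
        ‖(xn n (lam n ↑t), zn n (lam n ↑t)) - (x ↑t, z ↑t)‖) := by
      intro n
      obtain ⟨C₁, h₁⟩ := (hxc n).exists_norm_le 0 (lam n T)
      obtain ⟨C₂, h₂⟩ := (hzc n).exists_norm_le 0 (lam n T)
      obtain ⟨C₃, h₃⟩ := hxcl.exists_norm_le 0 T
      obtain ⟨C₄, h₄⟩ := hzcl.exists_norm_le 0 T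
      refine ⟨max (C₁ + C₃) (C₂ + C₄), ?_⟩
      rintro _ ⟨⟨t, ht⟩, rfl⟩
      have hmem : lam n t ∈ Icc 0 (lam n T) :=
        ⟨hlam0 n ▸ (hmono n).monotone ht.1, (hmono n).monotone ht.2⟩
      exact max_le_max ((norm_sub_le _ _).trans (add_le_add (h₁ _ hmem) (h₃ _ ht)))
        ((norm_sub_le _ _).trans (add_le_add (h₂ _ hmem) (h₄ _ ht)))
    filter_upwards [eventually_forall_le_of_tendsto_iSup (hT T hT0).2 hbdd hε] with n hn t ht
    exact max_le_iff.1 (hn ⟨t, ht⟩)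
  -- uniform variation bounds for the time-changed paths and their limits
  have hvar : ∀ T : ℝ, 0 < T → ∃ A > 0, ∃ B > 0,
      (∀ᶠ n in atTop, VarBound q (fun t => xn n (lam n t)) 0 T A ∧
        VarBound p (fun t => zn n (lam n t)) 0 T B) ∧
      VarBound q x 0 T A ∧ VarBound p z 0 T B := by
    intro T hT0
    have hT1 : 0 ≤ T + 1 := by linarith
    obtain ⟨M, hM⟩ := hxb (T + 1) hT1
    obtain ⟨N, hN⟩ := hzb (T + 1) hT1
    obtain ⟨A, hA, hxA⟩ := exists_varBound hq (fun n => hxf n (T + 1) hT1)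
      fun n => (le_add_of_nonneg_right (norm_nonneg _)).trans (hM n)
    obtain ⟨B, hB, hzB⟩ := exists_varBound hp (fun n => hzf n (T + 1) hT1) hN
    have hev : ∀ᶠ n in atTop, VarBound q (fun t => xn n (lam n t)) 0 T A ∧
        VarBound p (fun t => zn n (lam n t)) 0 T B := by
      filter_upwards [htime T hT0] with n hn
      exact ⟨(hxA n).comp (hmono n).monotone hn, (hzB n).comp (hmono n).monotone hn⟩
    refine ⟨A, hA, B, hB, hev, ?_, ?_⟩
    · refine VarBound.of_tendsto hq (fun t ht => ?_) (hev.mono fun n h => h.1)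
      refine tendsto_iff_norm_sub_tendsto_zero.2 (Metric.tendsto_nhds.2 fun ε hε => ?_)
      filter_upwards [hunif T hT0 (ε / 2) (by linarith)] with n hn
      rw [Real.dist_0_eq_abs, abs_norm]
      linarith [(hn t ht).1]
    · refine VarBound.of_tendsto hp (fun t ht => ?_) (hev.mono fun n h => h.2)
      refine tendsto_iff_norm_sub_tendsto_zero.2 (Metric.tendsto_nhds.2 fun ε hε => ?_)
      filter_upwards [hunif T hT0 (ε / 2) (by linarith)] with n hn
      rw [Real.dist_0_eq_abs, abs_norm]
      linarith [(hn t ht).2]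
  -- Riemann–Stieltjes sums converge uniformly over partitions
  have hsums : ∀ T : ℝ, 0 < T → ∀ η > 0, ∀ᶠ m in atTop, ∀ (n : ℕ) (t : Fin (n + 1) → ℝ),
      Monotone t → t 0 = 0 → t (Fin.last n) ≤ T →
      ‖∑ i : Fin n, xn m (lam m (t i.castSucc))
          (zn m (lam m (t i.succ)) - zn m (lam m (t i.castSucc))) -
        ∑ i : Fin n, x (t i.castSucc) (z (t i.succ) - z (t i.castSucc))‖ ≤ η := by
    intro T hT0 η hη
    obtain ⟨A, hA, B, hB, hev, hxA, hzB⟩ := hvar T hT0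
    obtain ⟨ε, hε, h⟩ := exists_norm_finSum_sub_finSum_le (E := Eu d) (F := Eu d) hp hq hpq
      hA hB (norm_nonneg (x 0)) hη
    filter_upwards [hev, hunif T hT0 ε hε] with m hm hum
    exact h 0 T x (fun t => xn m (lam m t)) z (fun t => zn m (lam m t)) hxA hm.1 hzB hm.2 le_rfl
      (fun t ht => (hum t ht).1) (fun t ht => (hum t ht).2)
  have hInt : ∀ (n : ℕ) (t : ℝ), 0 ≤ t →
      IsRSInt (fun (A : Eu d →L[ℝ] Eu d) (v : Eu d) => A v) (fun s => xn n (lam n s))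
        (fun s => zn n (lam n s)) 0 t (In n (lam n t)) := by
    intro n t ht
    refine IsRSInt.comp (hmono n).monotone (hlamc n) ?_
    rw [hlam0 n]
    exact hIn n _ (hlam0 n ▸ (hmono n).monotone ht)
  have hcauchy : ∀ T : ℝ, 0 < T → ∀ η > 0, ∃ N, ∀ n ≥ N, ∀ m ≥ N, ∀ t ∈ Icc 0 T,
      ‖In n (lam n t) - In m (lam m t)‖ ≤ η := by
    intro T hT0 η hη
    obtain ⟨N, hN⟩ := eventually_atTop.1 (hsums T hT0 (η / 2) (by linarith))
    refine ⟨N, fun n hn m hm t ht =>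
      (hInt n t ht.1).norm_sub_le ht.1 (hInt m t ht.1) fun k s hs h0 hk => ?_⟩
    have h₁ := hN n hn k s hs h0 (hk.le.trans ht.2)
    have h₂ := hN m hm k s hs h0 (hk.le.trans ht.2)
    rw [norm_sub_rev] at h₂
    refine (norm_sub_le_norm_sub_add_norm_sub _ _ _).trans ((add_le_add h₁ h₂).trans ?_)
    linarith
  have hlimit : ∀ t : ℝ, ∃ l : Eu d,
      0 ≤ t → Tendsto (fun n => In n (lam n t)) atTop (nhds l) := by
    intro t
    by_cases ht : 0 ≤ t
    · have hc : CauchySeq fun n => In n (lam n t) := by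
        refine Metric.cauchySeq_iff.2 fun ε hε => ?_
        obtain ⟨N, hN⟩ := hcauchy (t + 1) (by linarith) (ε / 2) (by linarith)
        refine ⟨N, fun n hn m hm => ?_⟩
        rw [dist_eq_norm]
        linarith [hN n hn m hm t ⟨ht, by linarith⟩]
      obtain ⟨l, hl⟩ := cauchySeq_tendsto_of_complete hc
      exact ⟨l, fun _ => hl⟩
    · exact ⟨0, fun h => absurd h ht⟩
  choose I hI using hlimit
  have hIunif : ∀ T : ℝ, 0 < T → ∀ η > 0, ∀ᶠ n in atTop, ∀ t ∈ Icc 0 T,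
      ‖In n (lam n t) - I t‖ ≤ η := by
    intro T hT0 η hη
    obtain ⟨N, hN⟩ := hcauchy T hT0 η hη
    filter_upwards [eventually_ge_atTop N] with n hn t ht
    refine le_of_tendsto (tendsto_const_nhds.sub (hI t ht.1)).norm ?_
    filter_upwards [eventually_ge_atTop N] with m hm
    exact hN n hn m hm t ht
  refine ⟨fun T hT0 => ?_, I, ?_, fun t ht ε hε => ?_, lam, hmono, hsurj, hlam0,
    fun T hT0 => ⟨(hT T hT0).1, ?_⟩⟩
  · obtain ⟨A, -, B, -, -, hxA, hzB⟩ := hvar (T + 1) (by linarith)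
    have hsub : ∀ t ∈ Icc 0 T, t ∈ Icc 0 (T + 1) := fun t h => ⟨h.1, by linarith [h.2]⟩
    exact ⟨(hxA.comp monotone_id hsub).hasFinVar, (hzB.comp monotone_id hsub).hasFinVar⟩
  · refine tendsto_nhds_unique (hI 0 le_rfl) ?_
    simp [hlam0, hIn0]
  · obtain ⟨m, hm₁, hm₂⟩ := ((hsums (t + 1) (by linarith) (ε / 3) (by linarith)).and
      (hIunif (t + 1) (by linarith) (ε / 3) (by linarith))).exists
    obtain ⟨δ, hδ, h⟩ := hInt m t ht (ε / 3) (by linarith)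
    refine ⟨δ, hδ, fun n s hs h0 hn hmesh => ?_⟩
    have e₁ := hm₁ n s hs h0 (by linarith)
    have e₂ := h n s hs h0 hn hmesh
    have e₃ := hm₂ t ⟨ht, by linarith⟩
    rw [norm_sub_rev] at e₁
    have e₄ := norm_sub_le_norm_sub_add_norm_sub
      (∑ i : Fin n, x (s i.castSucc) (z (s i.succ) - z (s i.castSucc)))
      (∑ i : Fin n, xn m (lam m (s i.castSucc))
          (zn m (lam m (s i.succ)) - zn m (lam m (s i.castSucc)))) (I t)
    have e₅ := norm_sub_le_norm_sub_add_norm_sub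
      (∑ i : Fin n, xn m (lam m (s i.castSucc))
          (zn m (lam m (s i.succ)) - zn m (lam m (s i.castSucc)))) (In m (lam m t)) (I t)
    linarith
  · refine tendsto_iSup_of_eventually_forall_le (fun _ _ => norm_nonneg _) fun ε hε => ?_
    filter_upwards [hunif T hT0 ε hε, hIunif T hT0 ε hε] with n h₁ h₂
    rintro ⟨t, ht⟩
    exact max_le (h₁ t ht).1 (max_le (h₁ t ht).2 (h₂ t ht))
end
end

section
/- Let Z^H_t = ∫₀ᵗ σ_s dB^H_s, where B^H is a fractional Brownian motion with Hurst index H > 1/2 and σ : ℝ₊ → ℝ is measurable with ‖σ‖_{L^{1/H}[0,T]} = (∫₀ᵀ |σ_s|^{1/H} ds)^H < ∞ for every T. Then Z^H is a centered Gaussian process with continuous trajectories and for every p > 1/H and T ≥ 0, P(V_p(Z^H)_T < ∞) = 1. -/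
open Set Filter Function MeasureTheory

noncomputable section

/-- a real process is centered Gaussian: every finite linear combination of its
values has a centered Gaussian law. -/
def IsCenteredGaussianProcess {Ω : Type*} [MeasurableSpace Ω] (P : Measure Ω)
    (X : ℝ → Ω → ℝ) : Prop :=
  ∀ (n : ℕ) (c : Fin n → ℝ) (ts : Fin n → ℝ), ∃ v : NNReal,
    Measure.map (fun ω => ∑ i : Fin n, c i * X (ts i) ω) P =
      ProbabilityTheory.gaussianReal 0 v

theorem lintegral_comp_abs (g : ℝ → ENNReal) :
    ∫⁻ x : ℝ, g |x| = 2 * ∫⁻ x in Ioi (0 : ℝ), g x := by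
  have h1 : ∫⁻ x in Ioi (0 : ℝ), g |x| = ∫⁻ x in Ioi (0 : ℝ), g x :=
    setLIntegral_congr_fun measurableSet_Ioi fun x hx => by rw [abs_of_pos hx]
  have h2 : ∫⁻ x in Iio (0 : ℝ), g |x| = ∫⁻ x in Ioi (0 : ℝ), g x := by
    rw [← h1, ← lintegral_indicator measurableSet_Iio, ← lintegral_indicator measurableSet_Ioi,
      ← lintegral_neg_eq_self]
    refine lintegral_congr fun x => ?_
    simp [indicator]
  rw [← lintegral_add_compl _ (measurableSet_Ioi : MeasurableSet (Ioi (0 : ℝ))), compl_Ioi,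
    setLIntegral_congr Iio_ae_eq_Iic.symm, h1, h2, two_mul]

theorem lintegral_abs_rpow_near {r R : ℝ} (hr : -1 < r) (hR : 0 < R) :
    ∫⁻ x : ℝ, (Iic R).indicator (fun y => ENNReal.ofReal (y ^ r)) |x| =
      ENNReal.ofReal (2 * (R ^ (r + 1) / (r + 1))) := by
  rw [lintegral_comp_abs,
    ← lintegral_indicator measurableSet_Ioi, indicator_indicator, Ioi_inter_Iic,
    lintegral_indicator measurableSet_Ioc, ← ofReal_integral_eq_lintegral_ofReal,
    ← intervalIntegral.integral_of_le hR.le, integral_rpow (Or.inl hr),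
    Real.zero_rpow (by linarith), sub_zero, ENNReal.ofReal_mul (by norm_num)]
  · simp
  · exact (intervalIntegrable_iff_integrableOn_Ioc_of_le hR.le).1
      (intervalIntegral.intervalIntegrable_rpow' hr)
  · filter_upwards [ae_restrict_mem measurableSet_Ioc] with x hx
    exact Real.rpow_nonneg hx.1.le _

theorem lintegral_abs_rpow_far {r R : ℝ} (hr : r < -1) (hR : 0 < R) :
    ∫⁻ x : ℝ, (Ioi R).indicator (fun y => ENNReal.ofReal (y ^ r)) |x| =
      ENNReal.ofReal (2 * (R ^ (r + 1) / (-(r + 1)))) := by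
  rw [lintegral_comp_abs,
    ← lintegral_indicator measurableSet_Ioi, indicator_indicator, Ioi_inter_Ioi,
    sup_of_le_right hR.le,
    lintegral_indicator measurableSet_Ioi, ← ofReal_integral_eq_lintegral_ofReal,
    integral_Ioi_rpow_of_lt hr hR, ENNReal.ofReal_mul (by norm_num), neg_div, div_neg]
  · simp
  · exact integrableOn_Ioi_rpow_of_lt hr hR
  · filter_upwards [ae_restrict_mem measurableSet_Ioi] with x hx
    exact Real.rpow_nonneg (hR.le.trans (le_of_lt hx)) _

theorem lintegral_riesz_inner_le {H a R : ℝ} (hH : 1 / 2 < H) (hH1 : H < 1) {μ : Measure ℝ}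
    (hμ : μ ≤ volume) {f : ℝ → ℝ} (hf : Measurable f) (hf0 : ∀ x, 0 ≤ f x)
    (hi : Integrable (fun x => f x ^ (1 / H)) μ) (ha : 0 ≤ a) (hR : 0 < R) (u : ℝ) :
    ∫⁻ v, (f ⁻¹' Iic a).indicator (fun v => ENNReal.ofReal (f v * |u - v| ^ (2 * H - 2))) v ∂μ ≤
      ENNReal.ofReal (a * (2 * (R ^ (2 * H - 1) / (2 * H - 1))) +
        (∫ x, f x ^ (1 / H) ∂μ) ^ H * (2 / R) ^ (1 - H)) := by
  set near : ℝ → ENNReal := (Iic R).indicator fun y => ENNReal.ofReal (y ^ (2 * H - 2)) with hnear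
  set far : ℝ → ENNReal := (Ioi R).indicator fun y => ENNReal.ofReal (y ^ (2 * H - 2)) with hfar
  have hm : Measurable fun y : ℝ => ENNReal.ofReal (y ^ (2 * H - 2)) := by fun_prop
  have hnm : Measurable near := hm.indicator measurableSet_Iic
  have hfm : Measurable far := hm.indicator measurableSet_Ioi
  have hF : 0 ≤ ∫ x, f x ^ (1 / H) ∂μ := integral_nonneg fun x => Real.rpow_nonneg (hf0 x) _
  have hpt : ∀ v, (f ⁻¹' Iic a).indicator
      (fun v => ENNReal.ofReal (f v * |u - v| ^ (2 * H - 2))) v ≤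
      ENNReal.ofReal a * near |u - v| + ENNReal.ofReal (f v) * far |u - v| := by
    intro v
    by_cases hv : f v ≤ a
    · rw [indicator_of_mem (by exact hv), ENNReal.ofReal_mul (hf0 v)]
      rcases le_or_gt |u - v| R with h | h
      · rw [hnear, indicator_of_mem (by exact h)]
        exact le_add_right (mul_le_mul_left (ENNReal.ofReal_le_ofReal hv) _)
      · rw [hfar, indicator_of_mem (by exact h)]
        exact le_add_left le_rfl
    · rw [indicator_of_notMem (by exact hv)]
      exact zero_le
  refine (lintegral_mono hpt).trans ?_
  rw [lintegral_add_left (by fun_prop), lintegral_const_mul _ (by fun_prop), ENNReal.ofReal_add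
    (by have : 0 < 2 * H - 1 := by linarith
        positivity) (by positivity), ENNReal.ofReal_mul ha]
  refine add_le_add (mul_le_mul_right ?_ _) ?_
  · refine (lintegral_mono' hμ le_rfl).trans ?_
    rw [lintegral_sub_left_eq_self (fun x => near |x|) u, hnear,
      lintegral_abs_rpow_near (by linarith) hR]
    ring_nf
    exact le_rfl
  · have hpq : (1 / H).HolderConjugate (1 / (1 - H)) := by
      rw [Real.holderConjugate_iff]
      constructor
      · rw [lt_div_iff₀] <;> linarith
      · simp
    refine (ENNReal.lintegral_mul_le_Lp_mul_Lq μ hpq (by fun_prop) (by fun_prop)).trans ?_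
    rw [ENNReal.ofReal_mul (by positivity)]
    refine mul_le_mul' ?_ ?_
    · rw [one_div_one_div, ← ENNReal.ofReal_rpow_of_nonneg hF (by linarith),
        ofReal_integral_eq_lintegral_ofReal hi
          (ae_of_all _ fun x => Real.rpow_nonneg (hf0 x) _)]
      refine ENNReal.rpow_le_rpow (lintegral_mono fun x => ?_) (by linarith)
      exact (ENNReal.ofReal_rpow_of_nonneg (hf0 x) (by positivity)).le
    · rw [one_div_one_div, ← ENNReal.ofReal_rpow_of_nonneg (by positivity) (by linarith)]
      refine ENNReal.rpow_le_rpow ?_ (by linarith)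
      have he : ∀ y : ℝ, far |y| ^ (1 / (1 - H)) =
          (Ioi R).indicator (fun y => ENNReal.ofReal (y ^ (-2 : ℝ))) |y| := by
        intro y
        by_cases hy : |y| ∈ Ioi R
        · rw [hfar, indicator_of_mem hy, indicator_of_mem hy,
            ENNReal.ofReal_rpow_of_nonneg (by positivity) (by
              have : 0 < 1 - H := by linarith
              positivity), ← Real.rpow_mul (abs_nonneg y)]
          congr 2
          have : 1 - H ≠ 0 := by linarith
          field_simp
          ring
        · rw [hfar, indicator_of_notMem hy, indicator_of_notMem hy, ENNReal.zero_rpow_of_pos]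
          have : 0 < 1 - H := by linarith
          positivity
      refine (lintegral_mono' hμ le_rfl).trans ?_
      rw [lintegral_sub_left_eq_self (fun x => far |x| ^ (1 / (1 - H))) u, lintegral_congr he,
        lintegral_abs_rpow_far (by norm_num) hR]
      norm_num [Real.rpow_neg_one]
      rw [div_eq_mul_inv, ENNReal.ofReal_mul (by norm_num), ENNReal.ofReal_ofNat]

/-- The diagonal case of the Hardy–Littlewood–Sobolev inequality on the line. -/
theorem lintegral_riesz_le {H : ℝ} (hH : 1 / 2 < H) (hH1 : H < 1) {μ : Measure ℝ} [SFinite μ]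
    (hμ : μ ≤ volume) {f : ℝ → ℝ} (hf : Measurable f) (hf0 : ∀ x, 0 ≤ f x)
    (hi : Integrable (fun x => f x ^ (1 / H)) μ) :
    ∫⁻ u, ∫⁻ v, ENNReal.ofReal (f u * f v * |u - v| ^ (2 * H - 2)) ∂μ ∂μ ≤
      ENNReal.ofReal (2 * (2 / (2 * H - 1) + 2 ^ (1 - H)) *
        (∫ x, f x ^ (1 / H) ∂μ) ^ (2 * H)) := by
  set F := ∫ x, f x ^ (1 / H) ∂μ with hF
  have hF0 : 0 ≤ F := integral_nonneg fun x => Real.rpow_nonneg (hf0 x) _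
  set D : ℝ := 2 / (2 * H - 1) + 2 ^ (1 - H) with hD
  have hH2 : 0 < 2 * H - 1 := by linarith
  have hD0 : 0 ≤ D := by positivity
  set g : ℝ → ℝ → ENNReal := fun u v => ENNReal.ofReal (f u * f v * |u - v| ^ (2 * H - 2)) with hg
  have hgm : Measurable (uncurry g) := by
    simp only [hg, uncurry_def]; fun_prop
  set h : ℝ → ℝ → ENNReal := fun u v => {z : ℝ × ℝ | f z.2 ≤ f z.1}.indicator (uncurry g) (u, v)
    with hh
  have hhm : Measurable (uncurry h) :=
    hgm.indicator (measurableSet_le (by fun_prop) (by fun_prop))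
  have hgh : ∀ u v, g u v ≤ h u v + h v u := by
    intro u v
    rcases le_total (f v) (f u) with h1 | h1
    · simp only [hh, hg, indicator, mem_ofPred_eq, h1, if_true, uncurry]
      exact le_add_right le_rfl
    · simp only [hh, hg, indicator, mem_ofPred_eq, h1, if_true, uncurry]
      refine le_add_left (le_of_eq ?_)
      rw [abs_sub_comm, mul_comm (f u)]
  have hin : ∀ᵐ u ∂μ, ∫⁻ v, h u v ∂μ ≤ ENNReal.ofReal (D * F ^ (2 * H - 1) * f u ^ (1 / H)) := by
    have hz : F = 0 → ∀ᵐ u ∂μ, f u = 0 := by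
      intro h0
      have := (integral_eq_zero_iff_of_nonneg (fun x => Real.rpow_nonneg (hf0 x) _) hi).1 h0
      filter_upwards [this] with u hu
      exact (Real.rpow_eq_zero (hf0 u) (by positivity)).1 hu
    have hz' : ∀ᵐ u ∂μ, F = 0 → f u = 0 := by
      by_cases h0 : F = 0
      · filter_upwards [hz h0] with u hu _ using hu
      · exact ae_of_all _ fun u h => (h0 h).elim
    filter_upwards [hz'] with u hu
    rcases eq_or_lt_of_le (hf0 u) with h0 | h0
    · simp [hh, hg, indicator, uncurry, ← h0]
    have hFp : 0 < F := lt_of_le_of_ne hF0 fun h => h0.ne' (hu h.symm)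
    have hR : 0 < F * f u ^ (-(1 / H)) := by positivity
    have key := lintegral_riesz_inner_le hH hH1 hμ hf hf0 hi h0.le hR u
    have e1 : ∀ v, h u v = ENNReal.ofReal (f u) * (f ⁻¹' Iic (f u)).indicator
        (fun v => ENNReal.ofReal (f v * |u - v| ^ (2 * H - 2))) v := by
      intro v
      by_cases hv : f v ≤ f u
      · simp only [hh, hg, indicator, mem_ofPred_eq, hv, if_true, uncurry, mem_preimage, mem_Iic]
        rw [← ENNReal.ofReal_mul h0.le, mul_assoc]
      · simp [hh, indicator, hv]
    rw [lintegral_congr e1, lintegral_const_mul' _ _ ENNReal.ofReal_ne_top]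
    refine (mul_le_mul_right key _).trans ?_
    rw [← ENNReal.ofReal_mul h0.le]
    refine ENNReal.ofReal_le_ofReal (le_of_eq ?_)
    rw [← hF, hD, Real.mul_rpow hF0 (by positivity), ← Real.rpow_mul h0.le,
      Real.div_rpow (by norm_num) hR.le, Real.mul_rpow hF0 (by positivity), ← Real.rpow_mul h0.le]
    have e2 : f u * (f u * f u ^ (-(1 / H) * (2 * H - 1))) = f u ^ (1 / H) := by
      nth_rw 1 [← Real.rpow_one (f u)]
      nth_rw 2 [← Real.rpow_one (f u)]
      rw [← Real.rpow_add h0, ← Real.rpow_add h0]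
      congr 1
      field_simp
      ring
    have e3 : f u / f u ^ (-(1 / H) * (1 - H)) = f u ^ (1 / H) := by
      nth_rw 1 [← Real.rpow_one (f u)]
      rw [← Real.rpow_sub h0]
      congr 1
      field_simp
      ring
    have e4 : F ^ H / F ^ (1 - H) = F ^ (2 * H - 1) := by
      rw [← Real.rpow_sub hFp]
      congr 1
      ring
    calc _ = 2 / (2 * H - 1) * F ^ (2 * H - 1) * (f u * (f u * f u ^ (-(1 / H) * (2 * H - 1)))) +
          2 ^ (1 - H) * (F ^ H / F ^ (1 - H)) * (f u / f u ^ (-(1 / H) * (1 - H))) := by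
            ring
      _ = _ := by rw [e2, e3, e4]; ring
  have hI : ∫⁻ u, ∫⁻ v, h u v ∂μ ∂μ ≤ ENNReal.ofReal (D * F ^ (2 * H)) := by
    refine (lintegral_mono_ae hin).trans ?_
    rw [← ofReal_integral_eq_lintegral_ofReal (hi.const_mul _)
      (ae_of_all _ fun x => by have := hf0 x; positivity), integral_const_mul, ← hF]
    refine ENNReal.ofReal_le_ofReal (le_of_eq ?_)
    rcases eq_or_lt_of_le hF0 with h0 | h0
    · rw [← h0, mul_zero, Real.zero_rpow (by linarith), mul_zero]
    · nth_rw 2 [← Real.rpow_one F]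
      rw [mul_assoc, ← Real.rpow_add h0]
      congr 2
      ring
  calc _ ≤ ∫⁻ u, ∫⁻ v, (h u v + h v u) ∂μ ∂μ :=
        lintegral_mono fun u => lintegral_mono fun v => hgh u v
    _ = ∫⁻ u, ∫⁻ v, h u v ∂μ ∂μ + ∫⁻ u, ∫⁻ v, h v u ∂μ ∂μ := by
        rw [← lintegral_add_left hhm.lintegral_prod_right]
        refine lintegral_congr fun u => ?_
        rw [lintegral_add_left]
        exact hhm.comp (by fun_prop : Measurable fun v => (u, v))
    _ = 2 * ∫⁻ u, ∫⁻ v, h u v ∂μ ∂μ := by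
        rw [lintegral_lintegral_swap (f := fun u v => h v u), two_mul]
        exact (hhm.comp measurable_swap).aemeasurable
    _ ≤ 2 * ENNReal.ofReal (D * F ^ (2 * H)) := mul_le_mul_right hI _
    _ = _ := by
        rw [mul_assoc, ENNReal.ofReal_mul (p := 2) (by norm_num)]
        simp

theorem riesz_integrable_and_bound {H : ℝ} (hH : 1 / 2 < H) (hH1 : H < 1) {μ : Measure ℝ}
    [SFinite μ] (hμ : μ ≤ volume) {p : ENNReal} (hp : p = ENNReal.ofReal (1 / H)) [Fact (1 ≤ p)]
    (f g : Lp ℝ p μ) :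
    Integrable (fun z : ℝ × ℝ => f z.1 * g z.2 * |z.1 - z.2| ^ (2 * H - 2)) (μ.prod μ) ∧
    |∫ z, f z.1 * g z.2 * |z.1 - z.2| ^ (2 * H - 2) ∂(μ.prod μ)| ≤
      2 * (2 / (2 * H - 1) + 2 ^ (1 - H)) * (‖f‖ + ‖g‖) ^ 2 := by
  have hH0 : 0 < H := by linarith
  have hH2 : 0 < 2 * H - 1 := by linarith
  have hpr : p.toReal = 1 / H := hp ▸ ENNReal.toReal_ofReal (by positivity)
  have hp0 : p ≠ 0 := (zero_lt_one.trans_le (Fact.out : 1 ≤ p)).ne'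
  have hpt : p ≠ ⊤ := hp ▸ ENNReal.ofReal_ne_top
  have hfm : Measurable f := (Lp.stronglyMeasurable f).measurable
  have hgm : Measurable g := (Lp.stronglyMeasurable g).measurable
  set h : ℝ → ℝ := fun x => |f x| + |g x| with hh
  have hhm : Measurable h := by fun_prop
  have hh0 : ∀ x, 0 ≤ h x := fun x => by positivity
  have hL : MemLp h p μ := (Lp.memLp f).norm.add (Lp.memLp g).norm
  have hi : Integrable (fun x => h x ^ (1 / H)) μ := by
    refine (hL.integrable_norm_rpow hp0 hpt).congr (ae_of_all _ fun x => ?_)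
    simp only [hpr, Real.norm_of_nonneg (hh0 x)]
  have hF0 : 0 ≤ ∫ x, h x ^ (1 / H) ∂μ := integral_nonneg fun x => Real.rpow_nonneg (hh0 x) _
  have hFn : (∫ x, h x ^ (1 / H) ∂μ) ^ H ≤ ‖f‖ + ‖g‖ := by
    have e1 := hL.eLpNorm_eq_integral_rpow_norm hp0 hpt
    simp only [hpr, Real.norm_of_nonneg (hh0 _)] at e1
    rw [one_div H, inv_inv, ← one_div] at e1
    have e2 : eLpNorm h p μ ≤ eLpNorm f p μ + eLpNorm g p μ := by
      have := eLpNorm_add_le (Lp.memLp f).norm.1 (Lp.memLp g).norm.1 (Fact.out : 1 ≤ p)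
      rwa [eLpNorm_norm f, eLpNorm_norm g] at this
    rw [e1] at e2
    have e3 := ENNReal.toReal_mono
      (ENNReal.add_ne_top.2 ⟨Lp.eLpNorm_ne_top f, Lp.eLpNorm_ne_top g⟩) e2
    rwa [ENNReal.toReal_ofReal (by positivity),
      ENNReal.toReal_add (Lp.eLpNorm_ne_top f) (Lp.eLpNorm_ne_top g), ← Lp.norm_def,
      ← Lp.norm_def] at e3
  have hbd : ∀ z : ℝ × ℝ, ‖f z.1 * g z.2 * |z.1 - z.2| ^ (2 * H - 2)‖ ≤
      h z.1 * h z.2 * |z.1 - z.2| ^ (2 * H - 2) := by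
    intro z
    have h3 : 0 ≤ |z.1 - z.2| ^ (2 * H - 2) := by positivity
    rw [norm_mul, norm_mul, Real.norm_of_nonneg h3, Real.norm_eq_abs, Real.norm_eq_abs]
    refine mul_le_mul_of_nonneg_right (mul_le_mul ?_ ?_ (abs_nonneg _) (hh0 _)) h3
    · exact le_add_of_nonneg_right (abs_nonneg _)
    · exact le_add_of_nonneg_left (abs_nonneg _)
  have hKm : Measurable fun z : ℝ × ℝ => h z.1 * h z.2 * |z.1 - z.2| ^ (2 * H - 2) := by fun_prop
  have hK0 : ∀ z : ℝ × ℝ, 0 ≤ h z.1 * h z.2 * |z.1 - z.2| ^ (2 * H - 2) := fun z =>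
    mul_nonneg (mul_nonneg (hh0 _) (hh0 _)) (by positivity)
  have hlin : ∫⁻ z, ENNReal.ofReal (h z.1 * h z.2 * |z.1 - z.2| ^ (2 * H - 2)) ∂(μ.prod μ) ≤
      ENNReal.ofReal (2 * (2 / (2 * H - 1) + 2 ^ (1 - H)) *
        (∫ x, h x ^ (1 / H) ∂μ) ^ (2 * H)) := by
    rw [lintegral_prod _ (by fun_prop)]
    exact lintegral_riesz_le hH hH1 hμ hhm hh0 hi
  have hKi : Integrable (fun z : ℝ × ℝ => h z.1 * h z.2 * |z.1 - z.2| ^ (2 * H - 2))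
      (μ.prod μ) := by
    refine ⟨hKm.aestronglyMeasurable, ?_⟩
    rw [hasFiniteIntegral_iff_ofReal (ae_of_all _ hK0)]
    exact hlin.trans_lt ENNReal.ofReal_lt_top
  refine ⟨hKi.mono' (by fun_prop) (ae_of_all _ hbd), ?_⟩
  calc _ ≤ ∫ z, h z.1 * h z.2 * |z.1 - z.2| ^ (2 * H - 2) ∂(μ.prod μ) :=
        norm_integral_le_of_norm_le hKi (ae_of_all _ hbd)
    _ ≤ 2 * (2 / (2 * H - 1) + 2 ^ (1 - H)) * (∫ x, h x ^ (1 / H) ∂μ) ^ (2 * H) := by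
        rw [← ENNReal.ofReal_le_ofReal_iff (by positivity),
          ofReal_integral_eq_lintegral_ofReal hKi (ae_of_all _ hK0)]
        exact hlin
    _ ≤ _ := by
        rw [show (∫ x, h x ^ (1 / H) ∂μ) ^ (2 * H) = ((∫ x, h x ^ (1 / H) ∂μ) ^ H) ^ 2 by
          rw [mul_comm, Real.rpow_mul hF0, Real.rpow_two]]
        gcongr

theorem exists_rieszForm {H : ℝ} (hH : 1 / 2 < H) (hH1 : H < 1) {μ : Measure ℝ}
    [SFinite μ] (hμ : μ ≤ volume) {p : ENNReal} (hp : p = ENNReal.ofReal (1 / H)) [Fact (1 ≤ p)] :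
    ∃ Q : Lp ℝ p μ →L[ℝ] Lp ℝ p μ →L[ℝ] ℝ,
      ∀ f g, Q f g = ∫ z, f z.1 * g z.2 * |z.1 - z.2| ^ (2 * H - 2) ∂(μ.prod μ) := by
  have hH2 : 0 < 2 * H - 1 := by linarith
  have hI := fun f g => (riesz_integrable_and_bound hH hH1 hμ hp f g).1
  let B : Lp ℝ p μ →ₗ[ℝ] Lp ℝ p μ →ₗ[ℝ] ℝ :=
    LinearMap.mk₂ ℝ
      (fun f g => ∫ z, f z.1 * g z.2 * |z.1 - z.2| ^ (2 * H - 2) ∂(μ.prod μ))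
      (fun f f' g => by
        rw [← integral_add (hI f g) (hI f' g)]
        refine integral_congr_ae ?_
        filter_upwards [Measure.quasiMeasurePreserving_fst.ae (Lp.coeFn_add f f')] with z hz
        rw [hz, Pi.add_apply]; ring)
      (fun c f g => by
        rw [smul_eq_mul, ← integral_const_mul]
        refine integral_congr_ae ?_
        filter_upwards [Measure.quasiMeasurePreserving_fst.ae (Lp.coeFn_smul c f)] with z hz
        rw [hz, Pi.smul_apply, smul_eq_mul]; ring)
      (fun f g g' => by
        rw [← integral_add (hI f g) (hI f g')]
        refine integral_congr_ae ?_
        filter_upwards [Measure.quasiMeasurePreserving_snd.ae (Lp.coeFn_add g g')] with z hz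
        rw [hz, Pi.add_apply]; ring)
      (fun c f g => by
        rw [smul_eq_mul, ← integral_const_mul]
        refine integral_congr_ae ?_
        filter_upwards [Measure.quasiMeasurePreserving_snd.ae (Lp.coeFn_smul c g)] with z hz
        rw [hz, Pi.smul_apply, smul_eq_mul]; ring)
  set K : ℝ := 2 * (2 / (2 * H - 1) + 2 ^ (1 - H)) with hK
  have hB : ∀ f g, ‖B f g‖ ≤ K * (‖f‖ + ‖g‖) ^ 2 := fun f g =>
    (riesz_integrable_and_bound hH hH1 hμ hp f g).2
  refine ⟨B.mkContinuous₂ (4 * K) fun f g => ?_, fun f g => rfl⟩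
  by_cases hf : f = 0
  · simp [hf]
  by_cases hg : g = 0
  · simp [hg]
  have hf0 : 0 < ‖f‖ := norm_pos_iff.2 hf
  have hg0 : 0 < ‖g‖ := norm_pos_iff.2 hg
  have key := hB (‖f‖⁻¹ • f) (‖g‖⁻¹ • g)
  simp only [map_smul, LinearMap.smul_apply, norm_smul, norm_inv, norm_norm,
    inv_mul_cancel₀ hf0.ne', inv_mul_cancel₀ hg0.ne'] at key
  have : ‖B f g‖ = ‖f‖ * ‖g‖ * (‖g‖⁻¹ * (‖f‖⁻¹ * ‖B f g‖)) := by field_simp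
  rw [this]
  calc _ ≤ ‖f‖ * ‖g‖ * (K * (1 + 1) ^ 2) := by gcongr
    _ = _ := by ring

theorem tendsto_indicatorConstLp_of_monotone {α : Type*} [MeasurableSpace α] {μ : Measure α}
    {p : ENNReal} [Fact (1 ≤ p)] (hp : p ≠ ⊤) {s : ℕ → Set α} (hmono : Monotone s)
    (hs : ∀ n, MeasurableSet (s n)) (hμs : ∀ n, μ (s n) ≠ ⊤) {t : Set α} (ht : MeasurableSet t)
    (hμt : μ t ≠ ⊤) (hst : ⋃ n, s n = t) (c : ℝ) :
    Tendsto (fun n => indicatorConstLp p (hs n) (hμs n) c) atTop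
      (nhds (indicatorConstLp p ht hμt c)) := by
  refine tendsto_indicatorConstLp_set hp ?_
  have hsub : ∀ n, s n ⊆ t := fun n => hst ▸ subset_iUnion s n
  have h1 : ∀ n, μ (symmDiff (s n) t) = μ t - μ (s n) := by
    intro n
    rw [symmDiff_of_le (hsub n), measure_sdiff (hsub n) (hs n).nullMeasurableSet (hμs n)]
  simp only [h1]
  have h2 := tendsto_measure_iUnion_atTop (μ := μ) hmono
  rw [hst] at h2
  have h3 := ENNReal.Tendsto.sub (tendsto_const_nhds (x := μ t)) h2 (Or.inl hμt)
  rwa [tsub_self] at h3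

/-- Lebesgue measure on the positive half-line. -/
abbrev posVolume : Measure ℝ := volume.restrict (Ioi (0 : ℝ))

theorem posVolume_Ioc_ne_top (a b : ℝ) : posVolume (Ioc a b) ≠ ⊤ :=
  ((Measure.restrict_apply_le _ _).trans_lt measure_Ioc_lt_top).ne

/-- The indicator of `(0, t]` as an element of `L^p`. -/
def stepLp (p : ENNReal) (t : ℝ) : Lp ℝ p posVolume :=
  indicatorConstLp p measurableSet_Ioc (posVolume_Ioc_ne_top 0 t) 1

theorem mem_closure_span_stepLp {p : ENNReal} [Fact (1 ≤ p)] (hp : p ≠ ⊤)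
    (f : Lp ℝ p posVolume) :
    f ∈ (Submodule.span ℝ (range fun t : NNReal => stepLp p t)).topologicalClosure := by
  set S := (Submodule.span ℝ (range fun t : NNReal => stepLp p t)).topologicalClosure with hS
  have hcl : IsClosed (S : Set (Lp ℝ p posVolume)) := Submodule.isClosed_topologicalClosure _
  have hstep : ∀ t : ℝ, 0 ≤ t → stepLp p t ∈ S := fun t ht =>
    Submodule.le_topologicalClosure _ (Submodule.subset_span ⟨⟨t, ht⟩, rfl⟩)
  have hfin : ∀ (s : Set ℝ) (N : ℕ), posVolume (s ∩ Ioc 0 (N : ℝ)) ≠ ⊤ := fun s N =>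
    ((measure_mono inter_subset_right).trans_lt (posVolume_Ioc_ne_top 0 N).lt_top).ne
  have hset : ∀ s (hs : MeasurableSet s) (N : ℕ),
      indicatorConstLp p (hs.inter measurableSet_Ioc) (hfin s N) (1 : ℝ) ∈ S := by
    intro s hs N
    induction s, hs using MeasurableSpace.induction_on_inter (borel_eq_generateFrom_Iic ℝ)
      isPiSystem_Iic with
    | empty =>
      simp only [empty_inter]
      rw [indicatorConstLp_empty]
      exact S.zero_mem
    | basic t ht =>
      obtain ⟨a, rfl⟩ := ht
      have : Iic a ∩ Ioc (0 : ℝ) N = Ioc 0 (max 0 (min a N)) := by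
        ext x
        simp only [mem_inter_iff, mem_Iic, mem_Ioc, le_max_iff, le_min_iff]
        constructor
        · rintro ⟨h1, h2, h3⟩; exact ⟨h2, Or.inr ⟨h1, h3⟩⟩
        · rintro ⟨h1, h2 | h2⟩
          · linarith
          · exact ⟨h2.1, h1, h2.2⟩
      simp only [this]
      exact hstep _ (le_max_left _ _)
    | compl t ht ih =>
      have hd : Disjoint (t ∩ Ioc (0 : ℝ) N) (tᶜ ∩ Ioc (0 : ℝ) N) :=
        (disjoint_compl_right (a := t)).mono inter_subset_left inter_subset_left
      have := indicatorConstLp_disjoint_union (p := p) (ht.inter measurableSet_Ioc)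
        (ht.compl.inter measurableSet_Ioc) (hfin t N) (hfin tᶜ N) hd (1 : ℝ)
      have e : t ∩ Ioc (0 : ℝ) N ∪ tᶜ ∩ Ioc (0 : ℝ) N = Ioc (0 : ℝ) N := by
        rw [← union_inter_distrib_right, union_compl_self, univ_inter]
      simp only [e] at this
      rw [← sub_eq_iff_eq_add'] at this
      rw [← this]
      exact S.sub_mem (hstep _ (Nat.cast_nonneg N)) ih
    | iUnion g hd hg ih =>
      have hm : ∀ n, MeasurableSet (⋃ i < n, g i) := fun n =>
        MeasurableSet.biUnion (to_countable {i | i < n}) fun i _ => hg i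
      have hmem : ∀ n, indicatorConstLp p ((hm n).inter measurableSet_Ioc)
          (hfin (⋃ i < n, g i) N) (1 : ℝ) ∈ S := by
        intro n
        induction n with
        | zero =>
          simp only [not_lt_zero, iUnion_of_empty, iUnion_empty, empty_inter]
          rw [indicatorConstLp_empty]
          exact S.zero_mem
        | succ n ihn =>
          have e : (⋃ i < n + 1, g i) ∩ Ioc (0 : ℝ) N =
              ((⋃ i < n, g i) ∩ Ioc (0 : ℝ) N) ∪ (g n ∩ Ioc (0 : ℝ) N) := by
            rw [biUnion_lt_succ, union_inter_distrib_right]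
          have hdn : Disjoint ((⋃ i < n, g i) ∩ Ioc (0 : ℝ) N) (g n ∩ Ioc (0 : ℝ) N) := by
            refine Disjoint.mono inter_subset_left inter_subset_left ?_
            simp only [disjoint_iUnion_left]
            exact fun i hi => hd hi.ne
          simp only [e]
          rw [indicatorConstLp_disjoint_union ((hm n).inter measurableSet_Ioc)
            ((hg n).inter measurableSet_Ioc) (hfin _ N) (hfin _ N) hdn]
          exact S.add_mem ihn (ih n)
      refine hcl.mem_of_tendsto (tendsto_indicatorConstLp_of_monotone hp ?_ _ _ _ _ ?_ 1)
        (Eventually.of_forall hmem)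
      · exact fun m n hmn => inter_subset_inter_left _
          (biUnion_subset_biUnion_left fun i (hi : i < m) => hi.trans_le hmn)
      · rw [← iUnion_inter]
        congr 1
        ext x
        simp only [mem_iUnion, exists_prop]
        exact ⟨fun ⟨_, i, _, h⟩ => ⟨i, h⟩, fun ⟨i, h⟩ => ⟨i + 1, i, Nat.lt_succ_self i, h⟩⟩
  have hall : ∀ s (hs : MeasurableSet s) (hμs : posVolume s ≠ ⊤),
      indicatorConstLp p hs hμs (1 : ℝ) ∈ S := by
    intro s hs hμs
    have hae : s =ᵐ[posVolume] (s ∩ Ioi 0 : Set ℝ) := by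
      filter_upwards [ae_restrict_mem measurableSet_Ioi] with x hx
      exact propext ⟨fun h => ⟨h, hx⟩, fun h => h.1⟩
    have hμ' : posVolume (s ∩ Ioi 0) ≠ ⊤ := by rwa [← measure_congr hae]
    have e : indicatorConstLp p hs hμs (1 : ℝ) =
        indicatorConstLp p (hs.inter measurableSet_Ioi) hμ' 1 :=
      (indicatorConstLp_inj _ _ _ _ one_ne_zero).2 hae
    rw [e]
    refine hcl.mem_of_tendsto (tendsto_indicatorConstLp_of_monotone hp ?_ _ _ _ _ ?_ 1)
        (Eventually.of_forall fun N => hset s hs N)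
    · exact fun m n hmn => inter_subset_inter_right _ (Ioc_subset_Ioc_right (by exact_mod_cast hmn))
    · rw [← inter_iUnion]
      congr 1
      ext x
      simp only [mem_iUnion, mem_Ioc, mem_Ioi]
      exact ⟨fun ⟨_, h⟩ => h.1, fun h => (exists_nat_ge x).imp fun n hn => ⟨h, hn⟩⟩
  refine Lp.induction hp (fun f => f ∈ S) ?_ ?_ hcl f
  · intro c s hs hμs
    rw [Lp.simpleFunc.coe_indicatorConst]
    have : indicatorConstLp p hs hμs.ne c = c • indicatorConstLp p hs hμs.ne (1 : ℝ) := by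
      simp only [indicatorConstLp]
      rw [← MemLp.toLp_const_smul]
      congr 1
      ext x
      by_cases hx : x ∈ s <;> simp [hx]
    rw [this]
    exact S.smul_mem _ (hall s hs hμs.ne)
  · intro f g hf hg _ h1 h2
    exact S.add_mem h1 h2

theorem intervalIntegrable_abs_rpow {r : ℝ} (hr : -1 < r) (a b : ℝ) :
    IntervalIntegrable (fun x : ℝ => |x| ^ r) volume a b := by
  have h0 : ∀ c : ℝ, 0 ≤ c → IntervalIntegrable (fun x : ℝ => |x| ^ r) volume 0 c := by
    intro c hc
    refine (intervalIntegral.intervalIntegrable_rpow' (a := 0) (b := c) hr).congr ?_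
    intro x hx
    rw [uIoc_of_le hc] at hx
    simp only [abs_of_pos hx.1]
  have h1 : ∀ c : ℝ, IntervalIntegrable (fun x : ℝ => |x| ^ r) volume 0 c := by
    intro c
    rcases le_total 0 c with hc | hc
    · exact h0 c hc
    · have := h0 (-c) (by linarith)
      rw [IntervalIntegrable.iff_comp_neg] at this
      simpa using this
  exact (h1 a).symm.trans (h1 b)

theorem integral_zero_abs_rpow {r : ℝ} (hr : -1 < r) (x : ℝ) :
    ∫ y in (0 : ℝ)..x, |y| ^ r = |x| ^ r * x / (r + 1) := by
  have h0 : ∀ c : ℝ, 0 ≤ c → ∫ y in (0 : ℝ)..c, |y| ^ r = |c| ^ r * c / (r + 1) := by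
    intro c hc
    rw [intervalIntegral.integral_congr (g := fun y => y ^ r) (fun y hy => by
      rw [uIcc_of_le hc] at hy
      simp only [abs_of_nonneg hy.1]), integral_rpow (Or.inl hr),
      Real.zero_rpow (by linarith), sub_zero, abs_of_nonneg hc]
    rcases eq_or_lt_of_le hc with h | h
    · rw [← h, Real.zero_rpow (by linarith), mul_zero]
    · rw [Real.rpow_add_one h.ne']
  rcases le_total 0 x with hx | hx
  · exact h0 x hx
  · have h1 := h0 (-x) (by linarith)
    have h2 := intervalIntegral.integral_comp_neg (a := 0) (b := x) (fun y : ℝ => |y| ^ r)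
    simp only [abs_neg, neg_zero] at h2
    rw [h2, intervalIntegral.integral_symm, h1, abs_neg]
    ring

theorem integral_riesz_kernel {H : ℝ} (hH : 1 / 2 < H) (s t : ℝ) :
    ∫ u in (0 : ℝ)..s, ∫ v in (0 : ℝ)..t, |u - v| ^ (2 * H - 2) =
      (|s| ^ (2 * H) + |t| ^ (2 * H) - |t - s| ^ (2 * H)) / (2 * H * (2 * H - 1)) := by
  have hr : -1 < 2 * H - 2 := by linarith
  have hH2 : 2 * H - 1 ≠ 0 := by linarith
  have hH0 : H ≠ 0 := by linarith
  set G : ℝ → ℝ := fun x => ∫ y in (0 : ℝ)..x, |y| ^ (2 * H - 2) with hG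
  have hGd : ∀ x, HasDerivAt (fun x : ℝ => |x| ^ (2 * H) / (2 * H * (2 * H - 1))) (G x) x := by
    intro x
    have := (hasDerivAt_abs_rpow x (p := 2 * H) (by linarith)).div_const (2 * H * (2 * H - 1))
    have e : G x = 2 * H * |x| ^ (2 * H - 2) * x / (2 * H * (2 * H - 1)) := by
      rw [hG]
      simp only
      rw [integral_zero_abs_rpow hr, show 2 * H - 2 + 1 = 2 * H - 1 by ring]
      field_simp
    rw [e]
    exact this
  have hGc : Continuous G :=
    intervalIntegral.continuous_primitive (fun a b => intervalIntegrable_abs_rpow hr a b) 0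
  have hin : ∀ u, ∫ v in (0 : ℝ)..t, |u - v| ^ (2 * H - 2) = G u - G (u - t) := by
    intro u
    rw [intervalIntegral.integral_comp_sub_left (fun x => |x| ^ (2 * H - 2)) u, sub_zero,
      intervalIntegral.integral_interval_sub_left (intervalIntegrable_abs_rpow hr _ _)
        (intervalIntegrable_abs_rpow hr _ _)]
  simp only [hin]
  rw [intervalIntegral.integral_eq_sub_of_hasDerivAt
    (f := fun x => |x| ^ (2 * H) / (2 * H * (2 * H - 1)) -
      |x - t| ^ (2 * H) / (2 * H * (2 * H - 1)))
    (fun x _ => (hGd x).sub ((hGd (x - t)).comp_sub_const x t))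
    (Continuous.intervalIntegrable (by fun_prop) _ _)]
  rw [abs_zero, Real.zero_rpow (by simpa using hH0), zero_sub, abs_neg, abs_sub_comm s t]
  ring

theorem integral_prod_indicator {r s t : ℝ} {φ ψ f g : ℝ → ℝ}
    (hf : f =ᵐ[posVolume] (Ioc 0 s).indicator φ) (hg : g =ᵐ[posVolume] (Ioc 0 t).indicator ψ)
    (hi : Integrable (fun z : ℝ × ℝ => f z.1 * g z.2 * |z.1 - z.2| ^ r)
      (posVolume.prod posVolume)) :
    ∫ z, f z.1 * g z.2 * |z.1 - z.2| ^ r ∂(posVolume.prod posVolume) =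
      ∫ u in Ioc 0 s, ∫ v in Ioc 0 t, φ u * ψ v * |u - v| ^ r := by
  have hrestr : ∀ (a : ℝ) (F : ℝ → ℝ),
      ∫ u, (Ioc 0 a).indicator F u ∂posVolume = ∫ u in Ioc 0 a, F u := by
    intro a F
    rw [integral_indicator measurableSet_Ioc, Measure.restrict_restrict measurableSet_Ioc,
      inter_eq_left.2 fun x hx => hx.1]
  rw [integral_prod _ hi, ← hrestr]
  refine integral_congr_ae ?_
  filter_upwards [hf] with u hu
  by_cases hus : u ∈ Ioc 0 s
  · rw [indicator_of_mem hus] at hu ⊢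
    rw [← hrestr]
    refine integral_congr_ae ?_
    filter_upwards [hg] with v hv
    by_cases hvt : v ∈ Ioc 0 t
    · rw [indicator_of_mem hvt] at hv ⊢
      rw [hu, hv]
    · rw [indicator_of_notMem hvt] at hv ⊢
      rw [hv]; ring
  · rw [indicator_of_notMem hus] at hu ⊢
    simp [hu]

section GaussianL2

variable {Ω : Type*} [MeasurableSpace Ω] {P : Measure Ω}

open ProbabilityTheory

theorem L2_norm_sq_eq_integral (X : Lp ℝ 2 P) : ‖X‖ ^ 2 = ∫ ω, X ω ^ 2 ∂P := by
  rw [← real_inner_self_eq_norm_sq, L2.inner_def]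
  refine integral_congr_ae (ae_of_all _ fun ω => ?_)
  simp [sq]

theorem eq_nnnorm_sq_of_map_eq_gaussianReal {X : Lp ℝ 2 P} {v : NNReal}
    (h : P.map X = gaussianReal 0 v) : v = ‖X‖₊ ^ 2 := by
  have hXm : Measurable X := (Lp.stronglyMeasurable X).measurable
  have h1 : ∫ x, x ^ 2 ∂(gaussianReal 0 v) = v := by
    rw [← variance_fun_id_gaussianReal (μ := 0) (v := v), variance_of_integral_eq_zero (by fun_prop)
      integral_id_gaussianReal]
  rw [← h, integral_map hXm.aemeasurable (by fun_prop), ← L2_norm_sq_eq_integral] at h1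
  exact NNReal.eq (by simpa using h1.symm)

theorem isClosed_map_eq_gaussianReal [IsProbabilityMeasure P] :
    IsClosed {X : Lp ℝ 2 P | P.map X = gaussianReal 0 (‖X‖₊ ^ 2)} := by
  refine IsSeqClosed.isClosed fun X Y hX hXY => ?_
  have hm : ∀ Z : Lp ℝ 2 P, AEMeasurable Z P := fun Z =>
    (Lp.stronglyMeasurable Z).measurable.aemeasurable
  obtain ⟨ns, hns, hae⟩ := (tendstoInMeasure_of_tendsto_Lp hXY).exists_seq_tendsto_ae
  have : IsProbabilityMeasure (P.map Y) := Measure.isProbabilityMeasure_map (hm Y)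
  refine Measure.ext_of_charFun (funext fun t => ?_)
  have hcf : ∀ Z : Lp ℝ 2 P, charFun (P.map Z) t = ∫ ω, Complex.exp (t * Z ω * Complex.I) ∂P :=
    fun Z => by rw [charFun_apply_real, integral_map (hm Z) (by fun_prop)]
  have h1 : Tendsto (fun n => charFun (P.map (X (ns n))) t) atTop (nhds (charFun (P.map Y) t)) := by
    simp only [hcf]
    refine tendsto_integral_of_dominated_convergence (fun _ => 1) (fun n => ?_)
      (integrable_const _) (fun n => ae_of_all _ fun ω => ?_) ?_
    · exact ((by fun_prop : Measurable fun x : ℝ => Complex.exp (t * x * Complex.I)).comp_aemeasurable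
        (hm _)).aestronglyMeasurable
    · rw [← Complex.ofReal_mul, Complex.norm_exp_ofReal_mul_I]
    · filter_upwards [hae] with ω hω
      exact ((by fun_prop : Continuous fun x : ℝ => Complex.exp (t * x * Complex.I)).tendsto _).comp hω
  have h2 : Tendsto (fun n => charFun (P.map (X (ns n))) t) atTop
      (nhds (charFun (gaussianReal 0 (‖Y‖₊ ^ 2)) t)) := by
    have h3 : ∀ n, charFun (P.map (X (ns n))) t = charFun (gaussianReal 0 (‖X (ns n)‖₊ ^ 2)) t :=
      fun n => by rw [show P.map (X (ns n)) = _ from hX (ns n)]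
    simp only [h3, charFun_gaussianReal]
    have h4 : Tendsto (fun n => ‖X (ns n)‖) atTop (nhds ‖Y‖) :=
      (hXY.comp hns.tendsto_atTop).norm
    simp only [NNReal.coe_pow, coe_nnnorm, Complex.ofReal_pow]
    exact ((by fun_prop : Continuous fun x : ℝ => Complex.exp (t * ((0 : ℝ) : ℂ) * Complex.I -
      (x : ℂ) ^ 2 * t ^ 2 / 2)).tendsto _).comp h4
  exact tendsto_nhds_unique h1 h2

theorem IsCenteredGaussianProcess.exists_map_finsum {B : ℝ → Ω → ℝ}
    (hB : IsCenteredGaussianProcess P B) (x : NNReal →₀ ℝ) :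
    ∃ v : NNReal, P.map (fun ω => ∑ t ∈ x.support, x t * B t ω) = gaussianReal 0 v := by
  let e := x.support.equivFin
  obtain ⟨v, hv⟩ := hB x.support.card (fun i => x (e.symm i)) (fun i => ((e.symm i : NNReal) : ℝ))
  refine ⟨v, ?_⟩
  rw [← hv]
  congr 1
  ext ω
  rw [← Finset.sum_coe_sort]
  exact (Equiv.sum_comp e.symm (fun t : x.support => x t * B ((t : NNReal) : ℝ) ω)).symm

theorem IsCenteredGaussianProcess.memLp_two {B : ℝ → Ω → ℝ}
    (hB : IsCenteredGaussianProcess P B) (hBm : ∀ t, Measurable (B t)) (t : ℝ) :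
    MemLp (B t) 2 P := by
  obtain ⟨v, hv⟩ := hB 1 (fun _ => 1) (fun _ => t)
  simp only [Finset.univ_unique, one_mul, Finset.sum_const, Finset.card_singleton, one_smul] at hv
  have h := memLp_id_gaussianReal (μ := 0) (v := v) 2
  rw [← hv] at h
  exact h.comp_of_map (hBm t).aemeasurable

end GaussianL2

theorem inner_fbm_eq_riesz {Ω : Type*} [MeasurableSpace Ω] {P : Measure Ω} {H : ℝ}
    (hH : 1 / 2 < H) (hH1 : H < 1) {B : ℝ → Ω → ℝ} (hB : ∀ t, MemLp (B t) 2 P)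
    (hBcov : ∀ s t : ℝ, 0 ≤ s → 0 ≤ t →
      ∫ ω, B s ω * B t ω ∂P = (s ^ (2 * H) + t ^ (2 * H) - |t - s| ^ (2 * H)) / 2)
    {p : ENNReal} (hp : p = ENNReal.ofReal (1 / H)) [Fact (1 ≤ p)] {s t : ℝ} (hs : 0 ≤ s)
    (ht : 0 ≤ t) :
    inner ℝ ((hB s).toLp (B s)) ((hB t).toLp (B t)) = H * (2 * H - 1) *
      ∫ z, stepLp p s z.1 * stepLp p t z.2 * |z.1 - z.2| ^ (2 * H - 2)
        ∂(posVolume.prod posVolume) := by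
  have h0 := integral_prod_indicator (s := s) (t := t) (f := stepLp p s) (g := stepLp p t)
    (φ := fun _ => 1) (ψ := fun _ => 1) indicatorConstLp_coeFn indicatorConstLp_coeFn
    (riesz_integrable_and_bound hH hH1 Measure.restrict_le_self hp _ _).1
  rw [h0]
  simp only [← intervalIntegral.integral_of_le hs, ← intervalIntegral.integral_of_le ht, one_mul]
  rw [integral_riesz_kernel hH, abs_of_nonneg hs, abs_of_nonneg ht, L2.inner_def]
  have h1 : ∫ ω, inner ℝ ((hB s).toLp (B s) ω) ((hB t).toLp (B t) ω) ∂P =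
      ∫ ω, B s ω * B t ω ∂P := by
    refine integral_congr_ae ?_
    filter_upwards [(hB s).coeFn_toLp, (hB t).coeFn_toLp] with ω h1 h2
    rw [h1, h2]
    simp [mul_comm]
  rw [h1, hBcov s t hs ht]
  have : 2 * H - 1 ≠ 0 := by linarith
  have : H ≠ 0 := by linarith
  field_simp

/-- The Wiener integral with respect to fractional Brownian motion on `L^{1/H}(0, ∞)`. -/
theorem exists_wienerIntegral {Ω : Type*} [MeasurableSpace Ω] {P : Measure Ω}
    [IsProbabilityMeasure P] {H : ℝ} (hH : 1 / 2 < H) (hH1 : H < 1) {B : ℝ → Ω → ℝ}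
    (hBmeas : ∀ t, Measurable (B t)) (hBgauss : IsCenteredGaussianProcess P B)
    (hBcov : ∀ s t : ℝ, 0 ≤ s → 0 ≤ t →
      ∫ ω, B s ω * B t ω ∂P = (s ^ (2 * H) + t ^ (2 * H) - |t - s| ^ (2 * H)) / 2)
    {p : ENNReal} (hp : p = ENNReal.ofReal (1 / H)) [Fact (1 ≤ p)] :
    ∃ I : Lp ℝ p posVolume →L[ℝ] Lp ℝ 2 P,
      (∀ f g, inner ℝ (I f) (I g) = H * (2 * H - 1) *
        ∫ z, f z.1 * g z.2 * |z.1 - z.2| ^ (2 * H - 2) ∂(posVolume.prod posVolume)) ∧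
      ∀ f, P.map (I f) = ProbabilityTheory.gaussianReal 0 (‖I f‖₊ ^ 2) := by
  have hp_top : p ≠ ⊤ := hp ▸ ENNReal.ofReal_ne_top
  have hB : ∀ t, MemLp (B t) 2 P := hBgauss.memLp_two hBmeas
  obtain ⟨Q, hQ⟩ := exists_rieszForm hH hH1 (μ := posVolume) Measure.restrict_le_self hp
  let e : (NNReal →₀ ℝ) →ₗ[ℝ] Lp ℝ p posVolume :=
    Finsupp.linearCombination ℝ fun t : NNReal => stepLp p t
  let b : (NNReal →₀ ℝ) →ₗ[ℝ] Lp ℝ 2 P :=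
    Finsupp.linearCombination ℝ fun t : NNReal => (hB t).toLp (B t)
  have hbe : ∀ x y, inner ℝ (b x) (b y) = H * (2 * H - 1) * Q (e x) (e y) := by
    intro x y
    induction x using Finsupp.induction_linear with
    | zero => simp
    | add x x' h h' => simp only [map_add, inner_add_left, add_apply, h, h']; ring
    | single s c =>
      induction y using Finsupp.induction_linear with
      | zero => simp
      | add y y' h h' => simp only [map_add, inner_add_right, h, h']; ring
      | single t d =>
        simp only [e, b, Finsupp.linearCombination_single, map_smul, smul_apply,
          real_inner_smul_left, real_inner_smul_right, smul_eq_mul]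
        have h := inner_fbm_eq_riesz hH hH1 hB hBcov hp (s := (s : ℝ)) (t := (t : ℝ))
          s.coe_nonneg t.coe_nonneg
        rw [h, hQ]
        ring
  have he : DenseRange e := by
    intro f
    have := mem_closure_span_stepLp hp_top f
    rw [← Finsupp.range_linearCombination] at this
    exact this
  have hbound : ∃ C, ∀ x, ‖b x‖ ≤ C * ‖e x‖ := by
    refine ⟨√(H * (2 * H - 1) * ‖Q‖), fun x => ?_⟩
    have hc : 0 ≤ H * (2 * H - 1) := mul_nonneg (by linarith) (by linarith)
    rw [← Real.sqrt_sq (norm_nonneg (e x)), ← Real.sqrt_mul (by positivity)]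
    refine Real.le_sqrt_of_sq_le ?_
    rw [← real_inner_self_eq_norm_sq, hbe, mul_assoc _ ‖Q‖]
    refine mul_le_mul_of_nonneg_left ?_ hc
    calc Q (e x) (e x) ≤ ‖Q (e x) (e x)‖ := le_abs_self _
      _ ≤ ‖Q‖ * ‖e x‖ * ‖e x‖ := Q.le_opNorm₂ _ _
      _ = _ := by ring
  set I := b.extendOfNorm e with hI
  have hIe : ∀ x, I (e x) = b x := fun x => LinearMap.extendOfNorm_eq he hbound x
  refine ⟨I, fun f g => ?_, fun f => ?_⟩
  · rw [← hQ]
    refine he.induction_on₂ (p := fun f g => inner ℝ (I f) (I g) = H * (2 * H - 1) * Q f g)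
      ?_ (fun x y => ?_) f g
    · exact isClosed_eq (by fun_prop) (by fun_prop)
    · rw [hIe, hIe, hbe]
  · refine he.induction_on (p := fun f => P.map (I f) =
      ProbabilityTheory.gaussianReal 0 (‖I f‖₊ ^ 2)) f
      (isClosed_map_eq_gaussianReal.preimage I.continuous) fun x => ?_
    rw [hIe]
    obtain ⟨v, hv⟩ := hBgauss.exists_map_finsum x
    have hae : b x =ᵐ[P] fun ω => ∑ t ∈ x.support, x t * B t ω := by
      have h1 : b x = ∑ t ∈ x.support, x t • (hB t).toLp (B t) := rfl
      rw [h1]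
      refine (Lp.coeFn_finsetSum _ _).trans ?_
      have h2 : ∀ᵐ ω ∂P, ∀ t ∈ x.support, (x t • (hB t).toLp (B t)) ω = x t * B t ω := by
        rw [Finset.eventually_all]
        intro t _
        filter_upwards [Lp.coeFn_smul (x t) ((hB t).toLp (B t)), (hB t).coeFn_toLp] with ω h3 h4
        rw [h3, Pi.smul_apply, h4, smul_eq_mul]
      filter_upwards [h2] with ω hω
      rw [Finset.sum_apply]
      exact Finset.sum_congr rfl hω
    rw [← Measure.map_congr hae] at hv
    rw [← eq_nnnorm_sq_of_map_eq_gaussianReal hv]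
    exact hv

/-- The largest dyadic number of level `n` below the nonnegative real `r`. -/
def dyadicFloor (n : ℕ) (r : ℝ) : ℝ := ⌊r * 2 ^ n⌋₊ / 2 ^ n

/-- The increments of `w` between consecutive dyadic numbers of level `n` in `[0, N]` are at most
`K * a ^ n`. -/
def DyadicIncrementsLE (w : ℝ → ℝ) (K a : ℝ) (N : ℕ) : Prop :=
  ∀ n k : ℕ, k < N * 2 ^ n → |w ((k + 1 : ℕ) / 2 ^ n) - w (k / 2 ^ n)| ≤ K * a ^ n

section DyadicChaining

theorem dist_dyadicFloor_succ_le {w : ℝ → ℝ} {K a : ℝ} {N : ℕ} (hK : 0 ≤ K) (ha : 0 ≤ a)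
    (h : DyadicIncrementsLE w K a N) {r : ℝ} (hr : 0 ≤ r) (hrN : r < N) (n : ℕ) :
    dist (w (dyadicFloor n r)) (w (dyadicFloor (n + 1) r)) ≤ K * a * a ^ n := by
  have hfl : ⌊r * 2 ^ n⌋₊ = ⌊r * 2 ^ (n + 1)⌋₊ / 2 := by
    rw [← Nat.floor_div_ofNat, pow_succ, ← mul_assoc]
    exact congrArg _ (mul_div_cancel_right₀ _ two_ne_zero).symm
  set m := ⌊r * 2 ^ (n + 1)⌋₊ with hm
  have hmN : m < N * 2 ^ (n + 1) := by
    rw [hm, Nat.floor_lt (by positivity)]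
    push_cast
    gcongr
  rw [mul_assoc, ← pow_succ', dist_comm, Real.dist_eq]
  rcases Nat.even_or_odd' m with ⟨k, hk | hk⟩
  · have : dyadicFloor (n + 1) r = dyadicFloor n r := by
      rw [dyadicFloor, dyadicFloor, hfl, ← hm, hk, Nat.mul_div_cancel_left _ two_pos, pow_succ]
      push_cast
      field_simp
    rw [this, sub_self, abs_zero]
    positivity
  · have h1 : dyadicFloor n r = (2 * k : ℕ) / 2 ^ (n + 1) := by
      rw [dyadicFloor, hfl, hk, Nat.mul_add_div two_pos, pow_succ]
      push_cast
      norm_num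
      field_simp
    have h2 : dyadicFloor (n + 1) r = (2 * k + 1 : ℕ) / 2 ^ (n + 1) := by
      rw [dyadicFloor, ← hm, hk]
    rw [h1, h2]
    exact h _ _ (by omega)

theorem DyadicIncrementsLE.exists_tendsto {w : ℝ → ℝ} {K a : ℝ} {N : ℕ} (hK : 0 ≤ K)
    (ha : 0 ≤ a) (ha1 : a < 1) (h : DyadicIncrementsLE w K a N) {r : ℝ} (hr : 0 ≤ r)
    (hrN : r < N) : ∃ l, Tendsto (fun n => w (dyadicFloor n r)) atTop (nhds l) :=
  cauchySeq_tendsto_of_complete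
    (cauchySeq_of_le_geometric a (K * a) ha1 (dist_dyadicFloor_succ_le hK ha h hr hrN))

theorem abs_sub_dyadicFloor_le {w : ℝ → ℝ} {K a : ℝ} {N : ℕ} (hK : 0 ≤ K) (ha : 0 ≤ a)
    (h : DyadicIncrementsLE w K a N) {r s : ℝ} (hr : 0 ≤ r) (hrs : r ≤ s) (hsN : s < N) {n : ℕ}
    (hn : s - r ≤ (1 / 2) ^ n) :
    |w (dyadicFloor n s) - w (dyadicFloor n r)| ≤ K * a ^ n := by
  have h1 : ⌊r * 2 ^ n⌋₊ ≤ ⌊s * 2 ^ n⌋₊ := Nat.floor_le_floor (by gcongr)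
  have h2 : ⌊s * 2 ^ n⌋₊ ≤ ⌊r * 2 ^ n⌋₊ + 1 := by
    rw [← Nat.floor_add_one (by positivity)]
    refine Nat.floor_le_floor ?_
    have : (s - r) * 2 ^ n ≤ (1 / 2) ^ n * 2 ^ n := by gcongr
    rw [← mul_pow] at this
    norm_num at this
    linarith
  rcases h1.eq_or_lt with h3 | h3
  · rw [dyadicFloor, dyadicFloor, h3, sub_self, abs_zero]
    positivity
  · have h4 : ⌊s * 2 ^ n⌋₊ = ⌊r * 2 ^ n⌋₊ + 1 := by omega
    rw [dyadicFloor, dyadicFloor, h4]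
    refine h _ _ ?_
    rw [Nat.floor_lt (by positivity)]
    push_cast
    gcongr
    linarith

theorem DyadicIncrementsLE.holder {w v : ℝ → ℝ} {K γ : ℝ} {N : ℕ} (hK : 0 ≤ K) (hγ : 0 < γ)
    (h : DyadicIncrementsLE w K ((1 / 2) ^ γ) N)
    (hv : ∀ r : ℝ, 0 ≤ r → r < N → Tendsto (fun n => w (dyadicFloor n r)) atTop (nhds (v r))) :
    ∃ C, 0 ≤ C ∧ ∀ r s : ℝ, 0 ≤ r → r ≤ s → s < N → s - r ≤ 1 → |v s - v r| ≤ C * (s - r) ^ γ := by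
  set a : ℝ := (1 / 2) ^ γ with ha_def
  have ha : 0 < a := by positivity
  have ha1 : a < 1 := Real.rpow_lt_one (by norm_num) (by norm_num) hγ
  have hlim : ∀ r : ℝ, 0 ≤ r → r < N → ∀ n, |w (dyadicFloor n r) - v r| ≤ K * a * a ^ n / (1 - a) :=
    fun r hr hrN n => dist_le_of_le_geometric_of_tendsto a (K * a) ha1
      (dist_dyadicFloor_succ_le hK ha.le h hr hrN) (hv r hr hrN) n
  have h1a : 0 < 1 - a := by linarith
  set L := K + 2 * (K * a / (1 - a)) with hL
  have hL0 : 0 ≤ L := by positivity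
  refine ⟨L / a, by positivity, fun r s hr hrs hsN hle => ?_⟩
  rcases hrs.eq_or_lt with rfl | hlt
  · simp only [sub_self, abs_zero]
    positivity
  obtain ⟨n, hn1, hn2⟩ := exists_nat_pow_near_of_lt_one (sub_pos.2 hlt) hle
    (by norm_num : (0 : ℝ) < 1 / 2) (by norm_num)
  have h1 := hlim r hr (by linarith) n
  have h2 := hlim s (by linarith) hsN n
  have h3 := abs_sub_dyadicFloor_le hK ha.le h hr hrs hsN hn2
  have h4 : |v s - v r| ≤ L * a ^ n := by
    have : L * a ^ n = K * a ^ n + K * a * a ^ n / (1 - a) + K * a * a ^ n / (1 - a) := by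
      rw [hL]; ring
    rw [this]
    rw [abs_le] at *
    constructor <;> linarith [h1.1, h1.2, h2.1, h2.2, h3.1, h3.2]
  refine h4.trans ?_
  have h5 : a ^ (n + 1) ≤ (s - r) ^ γ := by
    rw [ha_def, ← Real.rpow_natCast, ← Real.rpow_mul (by norm_num), mul_comm,
      Real.rpow_mul (by norm_num), Real.rpow_natCast]
    exact Real.rpow_le_rpow (by positivity) hn1.le hγ.le
  calc L * a ^ n = L / a * a ^ (n + 1) := by rw [pow_succ]; field_simp
    _ ≤ _ := by gcongr

end DyadicChaining

section Kolmogorov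

variable {Ω : Type*} [MeasurableSpace Ω] {P : Measure Ω}

theorem ae_exists_dyadicIncrementsLE {W : ℝ → Ω → ℝ} (hW : ∀ r, Measurable (W r)) {H γ : ℝ}
    (hγH : γ < H) (hmom : ∀ q : ℕ, ∃ M : ENNReal, M ≠ ⊤ ∧ ∀ r s, 0 ≤ r → 0 ≤ s →
      ∫⁻ ω, ‖W s ω - W r ω‖ₑ ^ q ∂P ≤ M * ENNReal.ofReal ((|s - r| ^ H) ^ q)) :
    ∀ᵐ ω ∂P, ∀ N : ℕ, ∃ K : ℝ, 0 ≤ K ∧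
      DyadicIncrementsLE (fun r => W r ω) K ((1 / 2) ^ γ) N := by
  set a : ℝ := (1 / 2) ^ γ with ha_def
  have ha : 0 < a := by positivity
  set b : ℝ := (1 / 2) ^ H with hb_def
  have hb : 0 < b := by positivity
  have hab : b / a < 1 := by
    rw [div_lt_one ha]
    exact Real.rpow_lt_rpow_of_exponent_gt (by norm_num) (by norm_num) hγH
  obtain ⟨q, hq⟩ := exists_pow_lt_of_lt_one (by norm_num : (0 : ℝ) < 1 / 2) hab
  have hq0 : q ≠ 0 := by
    rintro rfl
    norm_num at hq
  set ρ : ℝ := 2 * (b / a) ^ q with hρ_def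
  have hρ : 0 ≤ ρ := by positivity
  have hρ1 : ρ < 1 := by linarith
  obtain ⟨M, hM, hmom⟩ := hmom q
  rw [ae_all_iff]
  intro N
  set F : ℕ → ℕ → Ω → ENNReal := fun n k ω =>
    ‖(W ((k + 1 : ℕ) / 2 ^ n) ω - W (k / 2 ^ n) ω) / a ^ n‖ₑ ^ q with hF
  have hFm : ∀ n k, Measurable (F n k) := fun n k => by
    have := hW ((k + 1 : ℕ) / 2 ^ n)
    have := hW (k / 2 ^ n)
    fun_prop
  have hFint : ∀ n k, ∫⁻ ω, F n k ω ∂P ≤ M * ENNReal.ofReal (((b / a) ^ q) ^ n) := by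
    intro n k
    have h1 : ∀ ω, F n k ω =
        ENNReal.ofReal ((a ^ n)⁻¹ ^ q) * ‖W ((k + 1 : ℕ) / 2 ^ n) ω - W (k / 2 ^ n) ω‖ₑ ^ q := by
      intro ω
      rw [hF]
      simp only [div_eq_mul_inv, enorm_mul, mul_pow]
      rw [mul_comm, Real.enorm_eq_ofReal (by positivity : (0 : ℝ) ≤ (a ^ n)⁻¹),
        ENNReal.ofReal_pow (by positivity)]
    simp only [h1]
    have hm : Measurable fun ω => ‖W ((k + 1 : ℕ) / 2 ^ n) ω - W (k / 2 ^ n) ω‖ₑ ^ q := by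
      have := hW ((k + 1 : ℕ) / 2 ^ n)
      have := hW (k / 2 ^ n)
      fun_prop
    rw [lintegral_const_mul _ hm]
    refine (mul_le_mul_right (hmom _ _ (by positivity) (by positivity)) _).trans_eq ?_
    rw [mul_left_comm, ← ENNReal.ofReal_mul (by positivity)]
    congr 2
    have h2 : ((k + 1 : ℕ) : ℝ) / 2 ^ n - k / 2 ^ n = (1 / 2) ^ n := by
      push_cast
      rw [one_div, inv_pow]
      field_simp
      ring
    rw [h2, abs_of_nonneg (by positivity), ← Real.rpow_natCast (1 / 2), ← Real.rpow_mul
      (by norm_num), mul_comm (n : ℝ), Real.rpow_mul (by norm_num), Real.rpow_natCast, ← hb_def,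
      ← mul_pow, inv_mul_eq_div, ← div_pow, ← pow_mul, ← pow_mul, mul_comm]
  have hsum : ∫⁻ ω, ∑' n, ∑ k ∈ Finset.range (N * 2 ^ n), F n k ω ∂P ≠ ⊤ := by
    rw [lintegral_tsum fun n => (Finset.measurable_fun_sum _ fun k _ => hFm n k).aemeasurable]
    have h1 : ∀ n, ∫⁻ ω, ∑ k ∈ Finset.range (N * 2 ^ n), F n k ω ∂P ≤
        M * N * ENNReal.ofReal ρ ^ n := by
      intro n
      rw [lintegral_finsetSum _ fun k _ => hFm n k]
      refine (Finset.sum_le_sum fun k _ => hFint n k).trans_eq ?_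
      rw [Finset.sum_const, Finset.card_range, nsmul_eq_mul, ← ENNReal.ofReal_pow hρ, hρ_def,
        mul_pow, ENNReal.ofReal_mul (by positivity), ENNReal.ofReal_pow zero_le_two,
        ENNReal.ofReal_ofNat, ENNReal.ofReal_pow (by positivity)]
      push_cast
      ring
    refine ((ENNReal.tsum_le_tsum h1).trans_lt ?_).ne
    rw [ENNReal.tsum_mul_left, ENNReal.tsum_geometric]
    refine ENNReal.mul_lt_top (ENNReal.mul_lt_top hM.lt_top (ENNReal.natCast_lt_top N)) ?_
    rw [ENNReal.inv_lt_top, tsub_pos_iff_lt]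
    exact ENNReal.ofReal_lt_one.2 hρ1
  have hae := ae_lt_top (Measurable.tsum fun n =>
    Finset.measurable_fun_sum (Finset.range (N * 2 ^ n)) fun k _ => hFm n k) hsum
  filter_upwards [hae] with ω hω
  set S := ∑' n, ∑ k ∈ Finset.range (N * 2 ^ n), F n k ω with hS
  refine ⟨1 + S.toReal, by positivity, fun n k hk => ?_⟩
  have h1 : F n k ω ≤ S :=
    (Finset.single_le_sum (f := fun k => F n k ω) (fun _ _ => zero_le)
      (Finset.mem_range.2 hk)).trans
      (ENNReal.le_tsum (f := fun n => ∑ k ∈ Finset.range (N * 2 ^ n), F n k ω) n)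
  have h2 := ENNReal.toReal_mono hω.ne h1
  rw [hF] at h2
  simp only [ENNReal.toReal_pow, toReal_enorm, norm_div, Real.norm_eq_abs] at h2
  rw [abs_of_pos (pow_pos ha n)] at h2
  rw [← div_le_iff₀ (pow_pos ha n)]
  set x := |W ((k + 1 : ℕ) / 2 ^ n) ω - W (k / 2 ^ n) ω| / a ^ n with hx
  rcases le_total x 1 with h3 | h3
  · linarith [ENNReal.toReal_nonneg (a := S)]
  · linarith [le_self_pow₀ h3 hq0]

theorem tendsto_dyadicFloor {r : ℝ} (hr : 0 ≤ r) :
    Tendsto (fun n => dyadicFloor n r) atTop (nhds r) := by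
  have h := (tendsto_nat_floor_mul_div_atTop hr).comp
    (tendsto_pow_atTop_atTop_of_one_lt (r := (2 : ℝ)) one_lt_two)
  exact h

theorem continuousOn_of_local_holder {v : ℝ → ℝ} {γ : ℝ} (hγ : 0 < γ)
    (h : ∀ N : ℕ, ∃ C, 0 ≤ C ∧ ∀ r s : ℝ, 0 ≤ r → r ≤ s → s < N → s - r ≤ 1 →
      |v s - v r| ≤ C * (s - r) ^ γ) : ContinuousOn v (Ici 0) := by
  intro r hr
  obtain ⟨N, hN⟩ := exists_nat_gt (r + 1)
  obtain ⟨C, -, hC⟩ := h N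
  have hsymm : ∀ s ∈ Ici (0 : ℝ), |s - r| < 1 → dist (v s) (v r) ≤ C * |s - r| ^ γ := by
    intro s hs hsr
    rw [abs_lt] at hsr
    rcases le_total r s with hrs | hrs
    · rw [abs_of_nonneg (sub_nonneg.2 hrs), Real.dist_eq]
      exact hC r s hr hrs (by linarith) (by linarith)
    · rw [abs_sub_comm, abs_of_nonneg (sub_nonneg.2 hrs), dist_comm, Real.dist_eq]
      exact hC s r hs hrs (by linarith) (by linarith)
  refine tendsto_iff_dist_tendsto_zero.2 (squeeze_zero' (.of_forall fun _ => dist_nonneg)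
    (g := fun s => C * |s - r| ^ γ) ?_ ?_)
  · filter_upwards [self_mem_nhdsWithin,
      mem_nhdsWithin_of_mem_nhds (Metric.ball_mem_nhds r one_pos)] with s hs hsr
    exact hsymm s hs (by rwa [← Real.dist_eq])
  · have h1 : Tendsto (fun s => C * |s - r| ^ γ) (nhds r) (nhds (C * |r - r| ^ γ)) := by
      refine Continuous.tendsto ?_ r
      exact continuous_const.mul (Continuous.rpow_const (by fun_prop) fun _ => Or.inr hγ.le)
    rw [sub_self, abs_zero, Real.zero_rpow hγ.ne', mul_zero] at h1
    exact h1.mono_left nhdsWithin_le_nhds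

/-- Kolmogorov's continuity theorem on the half line `[0, ∞)`. -/
theorem exists_continuous_modification {W : ℝ → Ω → ℝ} (hW : ∀ r, Measurable (W r)) {H : ℝ}
    (hH : 0 < H) (hmom : ∀ q : ℕ, ∃ M : ENNReal, M ≠ ⊤ ∧ ∀ r s, 0 ≤ r → 0 ≤ s →
      ∫⁻ ω, ‖W s ω - W r ω‖ₑ ^ q ∂P ≤ M * ENNReal.ofReal ((|s - r| ^ H) ^ q)) :
    ∃ V : ℝ → Ω → ℝ, (∀ r, 0 ≤ r → Measurable (V r)) ∧
      (∀ ω, ContinuousOn (fun r => V r ω) (Ici 0)) ∧ (∀ r, 0 ≤ r → V r =ᵐ[P] W r) ∧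
      ∀ γ : ℝ, 0 < γ → γ < H → ∀ᵐ ω ∂P, ∀ N : ℕ, ∃ C, 0 ≤ C ∧ ∀ r s : ℝ, 0 ≤ r → r ≤ s → s < N →
        s - r ≤ 1 → |V s ω - V r ω| ≤ C * (s - r) ^ γ := by
  have hae : ∀ᵐ ω ∂P, ∀ N : ℕ, ∃ K : ℝ, 0 ≤ K ∧
      DyadicIncrementsLE (fun r => W r ω) K ((1 / 2) ^ (H / 2)) N :=
    ae_exists_dyadicIncrementsLE hW (half_lt_self hH) hmom
  obtain ⟨G, hGae, hGm, hG⟩ := hae.exists_measurable_mem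
  have hlim : ∀ (r : ℝ) (ω : Ω), ∃ l, 0 ≤ r →
      Tendsto (fun n => G.indicator (W (dyadicFloor n r)) ω) atTop (nhds l) := by
    intro r ω
    by_cases hr : 0 ≤ r
    · by_cases hω : ω ∈ G
      · obtain ⟨N, hN⟩ := exists_nat_gt r
        obtain ⟨K, hK, h⟩ := hG ω hω N
        obtain ⟨l, hl⟩ := h.exists_tendsto hK (by positivity)
          (Real.rpow_lt_one (by norm_num) (by norm_num) (by positivity)) hr hN
        exact ⟨l, fun _ => by simpa only [indicator_of_mem hω] using hl⟩
      · exact ⟨0, fun _ => by simp only [indicator_of_notMem hω]; exact tendsto_const_nhds⟩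
    · exact ⟨0, fun h => absurd h hr⟩
  choose V hV using hlim
  have hVG : ∀ ω ∈ G, ∀ r, 0 ≤ r →
      Tendsto (fun n => W (dyadicFloor n r) ω) atTop (nhds (V r ω)) := by
    intro ω hω r hr
    simpa only [indicator_of_mem hω] using hV r ω hr
  have hholder : ∀ γ : ℝ, 0 < γ → ∀ ω ∈ G, (∀ N : ℕ, ∃ K : ℝ, 0 ≤ K ∧
      DyadicIncrementsLE (fun r => W r ω) K ((1 / 2) ^ γ) N) → ∀ N : ℕ, ∃ C, 0 ≤ C ∧
      ∀ r s : ℝ, 0 ≤ r → r ≤ s → s < N → s - r ≤ 1 → |V s ω - V r ω| ≤ C * (s - r) ^ γ := by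
    intro γ hγ ω hω h N
    obtain ⟨K, hK, h⟩ := h N
    exact h.holder (v := fun r => V r ω) hK hγ fun r hr _ => hVG ω hω r hr
  refine ⟨V, fun r hr => ?_, fun ω => ?_, fun r hr => ?_, fun γ hγ hγH => ?_⟩
  · exact measurable_of_tendsto_metrizable (fun n => (hW (dyadicFloor n r)).indicator hGm)
      (tendsto_pi_nhds.2 fun ω => hV r ω hr)
  · by_cases hω : ω ∈ G
    · exact continuousOn_of_local_holder (half_pos hH) (hholder _ (half_pos hH) ω hω (hG ω hω))
    · refine continuousOn_const (c := (0 : ℝ)) |>.congr fun r hr => ?_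
      have := hV r ω hr
      simp only [indicator_of_notMem hω] at this
      exact tendsto_nhds_unique this tendsto_const_nhds
  · obtain ⟨M, hM, hmom⟩ := hmom 1
    have h1 : TendstoInMeasure P (fun n => W (dyadicFloor n r)) atTop (W r) := by
      refine tendstoInMeasure_of_tendsto_eLpNorm one_ne_zero
        (fun n => (hW _).aestronglyMeasurable) (hW r).aestronglyMeasurable ?_
      have h2 : Tendsto (fun n => M * ENNReal.ofReal (|dyadicFloor n r - r| ^ H)) atTop
          (nhds 0) := by
        have h3 : Tendsto (fun n => |dyadicFloor n r - r| ^ H) atTop (nhds 0) := by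
          have := (((tendsto_dyadicFloor hr).sub_const r).abs).rpow_const (p := H) (Or.inr hH.le)
          rwa [sub_self, abs_zero, Real.zero_rpow hH.ne'] at this
        have := ENNReal.Tendsto.const_mul (ENNReal.tendsto_ofReal h3) (Or.inr hM)
        rwa [ENNReal.ofReal_zero, mul_zero] at this
      refine tendsto_of_tendsto_of_tendsto_of_le_of_le tendsto_const_nhds h2
        (fun _ => zero_le) fun n => ?_
      rw [eLpNorm_one_eq_lintegral_enorm]
      simpa using hmom r (dyadicFloor n r) hr (by unfold dyadicFloor; positivity)
    obtain ⟨ns, hns, hae⟩ := h1.exists_seq_tendsto_ae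
    filter_upwards [hae, hGae] with ω h2 h3
    exact tendsto_nhds_unique ((hVG ω h3 r hr).comp hns.tendsto_atTop) h2
  · filter_upwards [ae_exists_dyadicIncrementsLE hW hγH hmom, hGae] with ω h1 h2
    exact hholder γ hγ ω h2 h1

end Kolmogorov

theorem exists_lintegral_gaussianReal_enorm_pow_le (q : ℕ) :
    ∃ M : ENNReal, M ≠ ⊤ ∧ ∀ v : NNReal,
      ∫⁻ x, ‖x‖ₑ ^ q ∂(ProbabilityTheory.gaussianReal 0 (v ^ 2)) = M * ENNReal.ofReal (v ^ q) := by
  refine ⟨∫⁻ x, ‖x‖ₑ ^ q ∂(ProbabilityTheory.gaussianReal 0 1), ?_, fun v => ?_⟩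
  · have h := (ProbabilityTheory.memLp_id_gaussianReal (μ := 0) (v := 1) q).eLpNorm_lt_top
    rcases eq_or_ne q 0 with rfl | hq
    · simp
    have h2 := lintegral_rpow_enorm_lt_top_of_eLpNorm_lt_top (by simpa using hq) (by simp) h
    simpa using h2.ne
  · have h := ProbabilityTheory.gaussianReal_map_const_mul (μ := 0) (v := 1) (v : ℝ)
    rw [mul_zero, mul_one] at h
    have h' : NNReal.mk ((v : ℝ) ^ 2) (sq_nonneg _) = v ^ 2 := rfl
    rw [← h', ← h, lintegral_map (by fun_prop) (by fun_prop)]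
    simp only [enorm_mul, mul_pow]
    rw [lintegral_const_mul _ (by fun_prop), mul_comm, ENNReal.ofReal_pow v.coe_nonneg,
      Real.enorm_eq_ofReal v.coe_nonneg]

theorem hasFinVar_comp_of_holder {v φ : ℝ → ℝ} {p C T : ℝ} (hp : 0 < p)
    (hC : 0 ≤ C) (hφ : Monotone φ)
    (h : ∀ r s, φ 0 ≤ r → r ≤ s → s ≤ φ T → |v s - v r| ≤ C * (s - r) ^ (1 / p)) :
    HasFinVar p (fun t => v (φ t)) 0 T := by
  refine ⟨C ^ p * (φ T - φ 0), ?_⟩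
  rintro _ ⟨n, t, ht, h0, hT, rfl⟩
  have h1 : ∀ i : Fin n, ‖v (φ (t i.succ)) - v (φ (t i.castSucc))‖ ^ p ≤
      C ^ p * (φ (t i.succ) - φ (t i.castSucc)) := by
    intro i
    have hle : φ (t i.castSucc) ≤ φ (t i.succ) := hφ (ht i.castSucc_lt_succ.le)
    have h2 := h _ _ (hφ (h0 ▸ ht (Fin.zero_le _))) hle (hφ (hT ▸ ht (Fin.le_last _)))
    calc _ ≤ (C * (φ (t i.succ) - φ (t i.castSucc)) ^ (1 / p)) ^ p :=
          Real.rpow_le_rpow (norm_nonneg _) h2 hp.le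
      _ = _ := by
        rw [Real.mul_rpow hC (Real.rpow_nonneg (sub_nonneg.2 hle) _),
          ← Real.rpow_mul (sub_nonneg.2 hle), one_div_mul_cancel hp.ne', Real.rpow_one]
  refine (Finset.sum_le_sum fun i _ => h1 i).trans_eq ?_
  rw [← Finset.mul_sum, ← h0, ← hT]
  congr 1
  have h3 : ∀ (m : ℕ) (g : Fin (m + 1) → ℝ),
      ∑ i : Fin m, (g i.succ - g i.castSucc) = g (Fin.last m) - g 0 := by
    intro m g
    have e1 := Fin.sum_univ_succ g
    have e2 := Fin.sum_univ_castSucc g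
    rw [Finset.sum_sub_distrib]
    linarith
  exact h3 n fun i => φ (t i)

theorem exists_holder_of_local_holder {v : ℝ → ℝ} {γ L : ℝ} (hγ : 0 < γ)
    (hv : ContinuousOn v (Ici 0))
    (h : ∀ N : ℕ, ∃ C, 0 ≤ C ∧ ∀ r s : ℝ, 0 ≤ r → r ≤ s → s < N → s - r ≤ 1 →
      |v s - v r| ≤ C * (s - r) ^ γ) :
    ∃ C, 0 ≤ C ∧ ∀ r s : ℝ, 0 ≤ r → r ≤ s → s ≤ L → |v s - v r| ≤ C * (s - r) ^ γ := by
  obtain ⟨N, hN⟩ := exists_nat_gt L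
  obtain ⟨C, hC, hC'⟩ := h N
  obtain ⟨M, hM⟩ := isCompact_Icc.exists_bound_of_continuousOn 
    (hv.mono (Icc_subset_Ici_self : Icc 0 L ⊆ Ici 0))
  refine ⟨max C (2 * M), le_max_of_le_left hC, fun r s hr hrs hsL => ?_⟩
  rcases le_total (s - r) 1 with h1 | h1
  · refine (hC' r s hr hrs (by linarith) h1).trans ?_
    gcongr
    exact le_max_left _ _
  · have h2 := hM r ⟨hr, hrs.trans hsL⟩
    have h3 := hM s ⟨hr.trans hrs, hsL⟩
    have h4 : 0 ≤ M := (norm_nonneg _).trans h2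
    calc |v s - v r| ≤ ‖v s‖ + ‖v r‖ := norm_sub_le (v s) (v r)
      _ ≤ 2 * M * 1 := by linarith
      _ ≤ max C (2 * M) * (s - r) ^ γ :=
        mul_le_mul (le_max_right _ _) (Real.one_le_rpow h1 hγ.le) zero_le_one
          (le_max_of_le_left hC)

/-- A continuous time change which dominates both time and the mass of a nonnegative locally
integrable density on `[0, ∞)`. -/
theorem exists_timeChange {τ : ℝ → ℝ} (hτ0 : ∀ s, 0 ≤ τ s)
    (hτ : ∀ T, 0 ≤ T → IntegrableOn τ (Icc 0 T) volume) :
    ∃ φ ψ : ℝ → ℝ, Continuous φ ∧ Monotone φ ∧ φ 0 = 0 ∧ (∀ t, φ (max t 0) = φ t) ∧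
      (∀ s t, 0 ≤ s → s ≤ t → ∫ u in Ioc s t, τ u ≤ φ t - φ s) ∧
      (∀ r, 0 ≤ r → 0 ≤ ψ r ∧ φ (ψ r) = r) ∧ ∀ t, 0 ≤ t → ψ (φ t) = t := by
  set τ' := (Ioi (0 : ℝ)).indicator τ with hτ'
  have hint : ∀ a b, IntervalIntegrable τ' volume a b := by
    have h0 : ∀ a, IntervalIntegrable τ' volume 0 a := by
      intro a
      rw [intervalIntegrable_iff, hτ', IntegrableOn, integrable_indicator_iff measurableSet_Ioi,
        IntegrableOn, Measure.restrict_restrict measurableSet_Ioi]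
      refine (hτ (max a 0) (le_max_right _ _)).mono_set ?_
      rintro x ⟨hx1, hx2⟩
      refine ⟨(mem_Ioi.1 hx1).le, hx2.2.trans ?_⟩
      rw [sup_comm]
    exact fun a b => (h0 a).symm.trans (h0 b)
  have hτ'0 : ∀ u, 0 ≤ τ' u := fun u => indicator_nonneg (fun x _ => hτ0 x) u
  set A : ℝ → ℝ := fun t => ∫ u in (0 : ℝ)..t, τ' u with hA
  have hAc : Continuous A := intervalIntegral.continuous_primitive hint 0
  have hAsub : ∀ s t, A t - A s = ∫ u in s..t, τ' u := fun s t =>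
    intervalIntegral.integral_interval_sub_left (hint 0 t) (hint 0 s)
  have hAmono : Monotone A := fun s t hst => by
    rw [← sub_nonneg, hAsub]
    exact intervalIntegral.integral_nonneg hst fun u _ => hτ'0 u
  set φ : ℝ → ℝ := fun t => max t 0 + A (max t 0) with hφ
  have hφc : Continuous φ := by fun_prop
  have hφm : Monotone φ := fun s t hst =>
    add_le_add (max_le_max_right 0 hst) (hAmono (max_le_max_right 0 hst))
  have hφ0 : φ 0 = 0 := by simp [hφ, hA]
  have hφsub : ∀ s t, 0 ≤ s → s ≤ t → t - s + (A t - A s) = φ t - φ s := by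
    intro s t hs hst
    simp only [hφ, max_eq_left hs, max_eq_left (hs.trans hst)]
    ring
  have hφinj : ∀ s t, 0 ≤ s → s < t → φ s < φ t := by
    intro s t hs hst
    linarith [hφsub s t hs hst.le, hAmono hst.le]
  have hsurj : ∀ r, ∃ t, 0 ≤ r → 0 ≤ t ∧ φ t = r := by
    intro r
    by_cases hr : 0 ≤ r
    · have h1 : r ≤ φ r := by
        linarith [hφsub 0 r le_rfl hr, hAmono hr]
      obtain ⟨t, ht, htr⟩ := intermediate_value_Icc hr hφc.continuousOn ⟨hφ0.trans_le hr, h1⟩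
      exact ⟨t, fun _ => ⟨ht.1, htr⟩⟩
    · exact ⟨0, fun h => absurd h hr⟩
  choose ψ hψ using hsurj
  refine ⟨φ, ψ, hφc, hφm, hφ0, fun t => by simp [hφ], fun s t hs hst => ?_, hψ, fun t ht => ?_⟩
  · have h1 : ∫ u in Ioc s t, τ u = A t - A s := by
      rw [hAsub, intervalIntegral.integral_of_le hst]
      refine setIntegral_congr_fun measurableSet_Ioc fun u hu => ?_
      exact (indicator_of_mem (mem_Ioi.2 (hs.trans_lt hu.1)) τ).symm
    linarith [hφsub s t hs hst]
  · obtain ⟨h1, h2⟩ := hψ (φ t) (hφ0 ▸ hφm ht)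
    rcases lt_trichotomy (ψ (φ t)) t with h | h | h
    · exact absurd h2 (hφinj _ _ h1 h).ne
    · exact h
    · exact absurd h2 (hφinj _ _ ht h).ne'

theorem exists_truncation {H : ℝ} (hH : 0 < H) {σ : ℝ → ℝ} (hσm : Measurable σ)
    (hσ : ∀ T : ℝ, 0 ≤ T → IntegrableOn (fun s => |σ s| ^ (1 / H)) (Icc 0 T) volume)
    {p : ENNReal} (hp : p = ENNReal.ofReal (1 / H)) [Fact (1 ≤ p)] :
    ∃ f : ℝ → Lp ℝ p posVolume, (∀ t, f t =ᵐ[posVolume] (Ioc 0 t).indicator σ) ∧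
      ∀ s t, 0 ≤ s → s ≤ t → ‖f t - f s‖ = (∫ u in Ioc s t, |σ u| ^ (1 / H)) ^ H := by
  have hp0 : p ≠ 0 := (zero_lt_one.trans_le (Fact.out : 1 ≤ p)).ne'
  have hpt : p ≠ ⊤ := hp ▸ ENNReal.ofReal_ne_top
  have hpr : p.toReal = 1 / H := hp ▸ ENNReal.toReal_ofReal (by positivity)
  have hmem : ∀ t, MemLp ((Ioc 0 t).indicator σ) p posVolume := by
    intro t
    rw [memLp_indicator_iff_restrict measurableSet_Ioc]
    refine (MemLp.mono_measure (Measure.restrict_mono_measure Measure.restrict_le_self _)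
      (?_ : MemLp σ p (volume.restrict (Ioc 0 t))))
    rw [← integrable_norm_rpow_iff hσm.aestronglyMeasurable hp0 hpt, hpr]
    refine (hσ (max t 0) (le_max_right _ _)).mono_set ?_
    exact fun x hx => ⟨hx.1.le, hx.2.trans (le_max_left _ _)⟩
  refine ⟨fun t => (hmem t).toLp _, fun t => (hmem t).coeFn_toLp, fun s t hs hst => ?_⟩
  rw [← MemLp.toLp_sub, Lp.norm_toLp,
    MemLp.eLpNorm_eq_integral_rpow_norm hp0 hpt ((hmem t).sub (hmem s)), hpr,
    ENNReal.toReal_ofReal (by positivity), one_div, inv_inv]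
  congr 1
  have h1 : (Ioc 0 t).indicator σ - (Ioc 0 s).indicator σ = (Ioc s t).indicator σ := by
    have h2 : Ioc 0 t = Ioc 0 s ∪ Ioc s t := (Ioc_union_Ioc_eq_Ioc hs hst).symm
    rw [h2, indicator_union_of_disjoint (Ioc_disjoint_Ioc_of_le le_rfl)]
    ext u
    simp
  rw [h1]
  have h3 : ∀ u, ‖(Ioc s t).indicator σ u‖ ^ H⁻¹ =
      (Ioc s t).indicator (fun u => |σ u| ^ H⁻¹) u := by
    intro u
    by_cases hu : u ∈ Ioc s t
    · simp [hu]
    · simp [hu, hH.ne']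
  simp only [h3]
  rw [integral_indicator measurableSet_Ioc, Measure.restrict_restrict measurableSet_Ioc,
    inter_eq_left.2 fun u hu => mem_Ioi.2 (hs.trans_lt hu.1)]

theorem fractional_wiener_integral_pvar (Ω : Type*) [MeasurableSpace Ω]
    (P : Measure Ω) [IsProbabilityMeasure P]
    (H : ℝ) (hH : 1 / 2 < H) (hH1 : H < 1)
    (B : ℝ → Ω → ℝ) (hBmeas : ∀ t, Measurable (B t))
    (hBgauss : IsCenteredGaussianProcess P B)
    (hBcov : ∀ s t : ℝ, 0 ≤ s → 0 ≤ t →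
      ∫ ω, B s ω * B t ω ∂P = (s ^ (2 * H) + t ^ (2 * H) - |t - s| ^ (2 * H)) / 2)
    (hBcont : ∀ ω, Continuous fun t => B t ω)
    (σ : ℝ → ℝ) (hσm : Measurable σ)
    (hσ : ∀ T : ℝ, 0 ≤ T → IntegrableOn (fun s => |σ s| ^ (1 / H)) (Icc 0 T) volume) :
    ∃ Z : ℝ → Ω → ℝ,
      (∀ t, Measurable (Z t)) ∧
      IsCenteredGaussianProcess P Z ∧
      (∀ s t : ℝ, 0 ≤ s → 0 ≤ t →
        ∫ ω, Z s ω * Z t ω ∂P =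
          H * (2 * H - 1) *
            ∫ u in Ioc (0:ℝ) s, ∫ v in Ioc (0:ℝ) t, σ u * σ v * |u - v| ^ (2 * H - 2)) ∧
      (∀ ω, Continuous fun t => Z t ω) ∧
      ∀ p T : ℝ, 1 / H < p → 0 ≤ T →
        P {ω | HasFinVar p (fun t => Z t ω) 0 T} = 1 := by
  have hH0 : 0 < H := by linarith
  obtain ⟨p, hp⟩ : ∃ p : ENNReal, p = ENNReal.ofReal (1 / H) := ⟨_, rfl⟩
  have : Fact (1 ≤ p) := ⟨by
    rw [hp, ENNReal.one_le_ofReal, le_div_iff₀ hH0]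
    linarith⟩
  obtain ⟨I, hI, hIgauss⟩ := exists_wienerIntegral hH hH1 hBmeas hBgauss hBcov hp
  obtain ⟨f, hf, hfsub⟩ := exists_truncation hH0 hσm hσ hp
  obtain ⟨φ, ψ, hφc, hφm, hφ0, hφmax, hφsub, hψ, hψφ⟩ :=
    exists_timeChange (fun s => Real.rpow_nonneg (abs_nonneg (σ s)) (1 / H)) hσ
  have hφpos : ∀ t, 0 ≤ φ t := fun t => by
    rw [← hφmax]
    exact hφ0.ge.trans (hφm (le_max_right t 0))
  have hψmono : ∀ r s, 0 ≤ r → r ≤ s → ψ r ≤ ψ s := by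
    intro r s hr hrs
    by_contra! h
    have h1 := hφm h.le
    rw [(hψ r hr).2, (hψ s (hr.trans hrs)).2] at h1
    rw [le_antisymm hrs h1] at h
    exact lt_irrefl _ h
  have hincr : ∀ r s, 0 ≤ r → r ≤ s → ‖I (f (ψ s)) - I (f (ψ r))‖ ≤ ‖I‖ * |s - r| ^ H := by
    intro r s hr hrs
    have hle := hψmono r s hr hrs
    rw [← map_sub]
    refine (I.le_opNorm _).trans (mul_le_mul_of_nonneg_left ?_ (norm_nonneg _))
    rw [hfsub _ _ (hψ r hr).1 hle, abs_of_nonneg (sub_nonneg.2 hrs)]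
    refine Real.rpow_le_rpow (integral_nonneg fun u => Real.rpow_nonneg (abs_nonneg _) _) ?_ hH0.le
    have := hφsub _ _ (hψ r hr).1 hle
    rwa [(hψ r hr).2, (hψ s (hr.trans hrs)).2] at this
  have hincr' : ∀ r s, 0 ≤ r → 0 ≤ s → ‖I (f (ψ s)) - I (f (ψ r))‖ ≤ ‖I‖ * |s - r| ^ H := by
    intro r s hr hs
    rcases le_total r s with h | h
    · exact hincr r s hr h
    · rw [norm_sub_rev, abs_sub_comm]
      exact hincr s r hs h
  have hmom : ∀ q : ℕ, ∃ M : ENNReal, M ≠ ⊤ ∧ ∀ r s, 0 ≤ r → 0 ≤ s →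
      ∫⁻ ω, ‖I (f (ψ s)) ω - I (f (ψ r)) ω‖ₑ ^ q ∂P ≤ M * ENNReal.ofReal ((|s - r| ^ H) ^ q) := by
    intro q
    obtain ⟨M, hM, hMq⟩ := exists_lintegral_gaussianReal_enorm_pow_le q
    refine ⟨M * ENNReal.ofReal (‖I‖ ^ q), ENNReal.mul_ne_top hM ENNReal.ofReal_ne_top,
      fun r s hr hs => ?_⟩
    have h1 : ∫⁻ ω, ‖I (f (ψ s)) ω - I (f (ψ r)) ω‖ₑ ^ q ∂P =
        ∫⁻ ω, ‖I (f (ψ s) - f (ψ r)) ω‖ₑ ^ q ∂P := by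
      refine lintegral_congr_ae ?_
      rw [map_sub]
      filter_upwards [Lp.coeFn_sub (I (f (ψ s))) (I (f (ψ r)))] with ω hω
      rw [hω, Pi.sub_apply]
    have h2 : Measurable (I (f (ψ s) - f (ψ r))) := (Lp.stronglyMeasurable _).measurable
    rw [h1, ← lintegral_map (f := fun x : ℝ => ‖x‖ₑ ^ q) (by fun_prop) h2, hIgauss, hMq, mul_assoc,
      ← ENNReal.ofReal_mul (by positivity), ← mul_pow]
    gcongr
    rw [map_sub]
    exact hincr' r s hr hs
  obtain ⟨V, hVm, hVc, hVW, hVh⟩ := exists_continuous_modification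
    (W := fun r ω => I (f (ψ r)) ω) (fun r => (Lp.stronglyMeasurable _).measurable) hH0 hmom
  have hZ : ∀ t, V (φ t) =ᵐ[P] I (f (max t 0)) := by
    intro t
    have := hVW (φ t) (hφpos t)
    rw [← hφmax, hψφ _ (le_max_right t 0), hφmax] at this
    exact this
  refine ⟨fun t => V (φ t), fun t => hVm _ (hφpos t), fun n c ts => ?_, fun s t hs ht => ?_,
    fun ω => ?_, fun r T hr hT => ?_⟩
  · refine ⟨‖I (∑ i, c i • f (max (ts i) 0))‖₊ ^ 2, ?_⟩
    rw [← hIgauss]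
    refine Measure.map_congr ?_
    rw [map_sum]
    have h1 : ∀ᵐ ω ∂P, ∀ i, I (c i • f (max (ts i) 0)) ω = c i * V (φ (ts i)) ω := by
      rw [ae_all_iff]
      intro i
      rw [map_smul]
      filter_upwards [Lp.coeFn_smul (c i) (I (f (max (ts i) 0))), hZ (ts i)] with ω h2 h3
      rw [h2, h3, Pi.smul_apply, smul_eq_mul]
    filter_upwards [Lp.coeFn_finsetSum Finset.univ fun i => I (c i • f (max (ts i) 0)), h1]
      with ω h2 h3
    rw [h2, Finset.sum_apply]
    exact Finset.sum_congr rfl fun i _ => (h3 i).symm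
  · have h1 := hI (f s) (f t)
    rw [integral_prod_indicator (hf s) (hf t)
      (riesz_integrable_and_bound hH hH1 Measure.restrict_le_self hp _ _).1, L2.inner_def] at h1
    rw [← h1]
    refine integral_congr_ae ?_
    have h2 := hZ s
    have h3 := hZ t
    rw [max_eq_left hs] at h2
    rw [max_eq_left ht] at h3
    filter_upwards [h2, h3] with ω h4 h5
    rw [h4, h5]
    simp [mul_comm]
  · exact (hVc ω).comp_continuous hφc hφpos
  · have hr0 : 0 < r := (one_div_pos.2 hH0).trans hr
    have h1 : ∀ᵐ ω ∂P, HasFinVar r (fun t => V (φ t) ω) 0 T := by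
      filter_upwards [hVh (1 / r) (one_div_pos.2 hr0) ((one_div_lt hr0 hH0).2 hr)] with ω hω
      obtain ⟨C, hC, hC'⟩ :=
        exists_holder_of_local_holder (v := fun a => V a ω) (γ := 1 / r) (L := φ T)
          (one_div_pos.2 hr0) (hVc ω) hω
      exact hasFinVar_comp_of_holder (v := fun a => V a ω) hr0 hC hφm fun a b ha hab hb => hC' a b (hφ0 ▸ ha) hab hb
    exact (measure_congr (eventuallyEq_univ.2 h1)).trans measure_univ
end
end
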